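/- Let B ⊆ 2^ω × 2^ω be a Borel set and ξ a countable ordinal with 3 ≤ ξ < ω₁. Then there is a continuous map ψ : 2^ω → 2^{2^{<ω}} such that {α ∈ 2^ω : B_α ∈ Σ^0_ξ(2^ω)} = ψ⁻¹(Σ_ξ) and {α ∈ 2^ω : B_α ∈ Π^0_ξ(2^ω)} = ψ⁻¹(Π_ξ), where B_α := {β : (α,β) ∈ B}. -/

import Mathlib

open Topology MeasureTheory TopologicalSpace

abbrev Cantor : Type := ℕ → Fin 2

/-- The concatenation of the first `m` words of the sequence `a`. -/
def concatPrefix {β : Type*} (a : ℕ → List β) (m : ℕ) : List β :=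
  ((List.range m).map a).flatten

/-- The ω-power of a set `A` of finite words: the set of all infinite words obtained by
concatenating a sequence of words of `A` (infinitely many of them being nonempty). -/
def omegaPower {β : Type*} (A : Set (List β)) : Set (ℕ → β) :=
  {α | ∃ a : ℕ → List β, (∀ i, a i ∈ A) ∧
    (∀ n, ∃ m, n ≤ (concatPrefix a m).length) ∧
    ∀ (m k : ℕ) (h : k < (concatPrefix a m).length), (concatPrefix a m).get ⟨k, h⟩ = α k}

/-- The Borel class Σ⁰_ξ of a topological space: Σ⁰_ξ is the class of open sets for ξ ≤ 1,
and for ξ ≥ 2 it consists of the countable unions of sets each lying in some Π⁰_η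
with 1 ≤ η < ξ. -/
noncomputable def SigmaZero (X : Type*) [TopologicalSpace X] (ξ : Ordinal.{0}) : Set (Set X) :=
  if ξ ≤ 1 then {s | IsOpen s}
  else {s | ∃ f : ℕ → Set X,
    (∀ n, ∃ η : Ordinal.{0}, ∃ _ : 1 ≤ η, ∃ _ : η < ξ, (f n)ᶜ ∈ SigmaZero X η) ∧
    s = ⋃ n, f n}
termination_by ξ

/-- The Borel class Π⁰_ξ: complements of Σ⁰_ξ sets. -/
noncomputable def PiZero (X : Type*) [TopologicalSpace X] (ξ : Ordinal.{0}) : Set (Set X) :=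
  {s | sᶜ ∈ SigmaZero X ξ}

/-- A topological space is zero-dimensional if it has a basis consisting of clopen sets. -/
def ZeroDim (X : Type*) [TopologicalSpace X] : Prop :=
  ∃ b : Set (Set X), IsTopologicalBasis b ∧ ∀ s ∈ b, IsClopen s

/-- The set of dictionaries whose ω-power is Σ⁰_ξ, as a subset of `2^{2^{<ω}}`. -/
def SigmaDict (ξ : Ordinal.{0}) : Set (List (Fin 2) → Bool) :=
  {A | omegaPower {w | A w = true} ∈ SigmaZero Cantor ξ}

/-- The set of dictionaries whose ω-power is Π⁰_ξ, as a subset of `2^{2^{<ω}}`. -/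
def PiDict (ξ : Ordinal.{0}) : Set (List (Fin 2) → Bool) :=
  {A | omegaPower {w | A w = true} ∈ PiZero Cantor ξ}

section Hierarchy

variable {X Y : Type*} [TopologicalSpace X] [TopologicalSpace Y] {ξ η : Ordinal.{0}}

theorem mem_sigmaZero_of_le_one (h : ξ ≤ 1) {s : Set X} : s ∈ SigmaZero X ξ ↔ IsOpen s := by
  rw [SigmaZero, if_pos h, Set.mem_ofPred_eq]

theorem mem_sigmaZero_of_one_lt (h : 1 < ξ) {s : Set X} :
    s ∈ SigmaZero X ξ ↔ ∃ f : ℕ → Set X,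
      (∀ n, ∃ η, 1 ≤ η ∧ η < ξ ∧ (f n)ᶜ ∈ SigmaZero X η) ∧ s = ⋃ n, f n := by
  rw [SigmaZero, if_neg h.not_ge, Set.mem_ofPred_eq]
  simp only [exists_prop]

theorem sigmaZero_preimage {f : X → Y} (hf : Continuous f) {s : Set Y}
    (hs : s ∈ SigmaZero Y ξ) : f ⁻¹' s ∈ SigmaZero X ξ := by
  induction ξ using WellFoundedLT.induction generalizing s with
  | ind ξ ih =>
    rcases le_or_gt ξ 1 with h | h
    · rw [mem_sigmaZero_of_le_one h] at hs ⊢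
      exact hs.preimage hf
    · rw [mem_sigmaZero_of_one_lt h] at hs ⊢
      obtain ⟨g, hg, rfl⟩ := hs
      refine ⟨fun n => f ⁻¹' g n, fun n => ?_, by simp⟩
      obtain ⟨η, h1, h2, h3⟩ := hg n
      exact ⟨η, h1, h2, ih η h2 h3⟩

theorem piZero_preimage {f : X → Y} (hf : Continuous f) {s : Set Y}
    (hs : s ∈ PiZero Y ξ) : f ⁻¹' s ∈ PiZero X ξ :=
  sigmaZero_preimage (s := sᶜ) hf hs

/-- Along an inducing map, every `Σ⁰_ξ` set is the trace of a `Σ⁰_ξ` set. -/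
theorem exists_sigmaZero_preimage_eq {f : X → Y} (hf : IsInducing f) {s : Set X}
    (hs : s ∈ SigmaZero X ξ) : ∃ t ∈ SigmaZero Y ξ, f ⁻¹' t = s := by
  induction ξ using WellFoundedLT.induction generalizing s with
  | ind ξ ih =>
    rcases le_or_gt ξ 1 with h | h
    · rw [mem_sigmaZero_of_le_one h] at hs
      obtain ⟨t, ht, rfl⟩ := hf.isOpen_iff.1 hs
      exact ⟨t, (mem_sigmaZero_of_le_one h).2 ht, rfl⟩
    · rw [mem_sigmaZero_of_one_lt h] at hs
      obtain ⟨g, hg, rfl⟩ := hs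
      choose η h1 h2 h3 using hg
      choose t ht htg using fun n => ih (η n) (h2 n) (h3 n)
      refine ⟨⋃ n, (t n)ᶜ, (mem_sigmaZero_of_one_lt h).2
        ⟨_, fun n => ⟨η n, h1 n, h2 n, by rw [compl_compl]; exact ht n⟩, rfl⟩, ?_⟩
      simp [Set.preimage_compl, htg]

theorem sigmaZero_iUnion_nat {f : ℕ → Set X} (hf : ∀ n, f n ∈ SigmaZero X ξ) :
    ⋃ n, f n ∈ SigmaZero X ξ := by
  rcases le_or_gt ξ 1 with h | h
  · simp only [mem_sigmaZero_of_le_one h] at hf ⊢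
    exact isOpen_iUnion hf
  · simp only [mem_sigmaZero_of_one_lt h] at hf ⊢
    choose g hg hfg using hf
    refine ⟨fun n => g n.unpair.1 n.unpair.2, fun n => hg _ _, ?_⟩
    rw [Set.iUnion_congr hfg]
    exact (Set.iUnion_unpair g).symm

theorem isOpen_mem_sigmaZero [MetrizableSpace X] {s : Set X} (hs : IsOpen s) :
    s ∈ SigmaZero X ξ := by
  rcases le_or_gt ξ 1 with h | h
  · rwa [mem_sigmaZero_of_le_one h]
  · let _ := metrizableSpaceMetric X
    obtain ⟨F, hF, -, hFs, -⟩ := hs.exists_iUnion_isClosed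
    refine (mem_sigmaZero_of_one_lt h).2 ⟨F, fun n => ⟨1, le_rfl, h, ?_⟩, hFs.symm⟩
    rw [mem_sigmaZero_of_le_one le_rfl]
    exact (hF n).isOpen_compl

theorem sigmaZero_iUnion [MetrizableSpace X] {ι : Type*} [Countable ι] {f : ι → Set X}
    (hf : ∀ n, f n ∈ SigmaZero X ξ) : ⋃ n, f n ∈ SigmaZero X ξ := by
  rcases isEmpty_or_nonempty ι with h | h
  · rw [Set.iUnion_of_empty]
    exact isOpen_mem_sigmaZero isOpen_empty
  · obtain ⟨e, he⟩ := exists_surjective_nat ι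
    rw [← he.iUnion_comp]
    exact sigmaZero_iUnion_nat fun n => hf (e n)

theorem sigmaZero_mono [MetrizableSpace X] (h : η ≤ ξ) {s : Set X} (hs : s ∈ SigmaZero X η) :
    s ∈ SigmaZero X ξ := by
  rcases le_or_gt η 1 with h1 | h1
  · exact isOpen_mem_sigmaZero ((mem_sigmaZero_of_le_one h1).1 hs)
  · rw [mem_sigmaZero_of_one_lt h1] at hs
    obtain ⟨g, hg, rfl⟩ := hs
    refine (mem_sigmaZero_of_one_lt (h1.trans_le h)).2 ⟨g, fun n => ?_, rfl⟩
    obtain ⟨ζ, h2, h3, h4⟩ := hg n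
    exact ⟨ζ, h2, h3.trans_le h, h4⟩

theorem sigmaZero_of_compl (h1 : 1 ≤ η) (h : η < ξ) {s : Set X} (hs : sᶜ ∈ SigmaZero X η) :
    s ∈ SigmaZero X ξ :=
  (mem_sigmaZero_of_one_lt (h1.trans_lt h)).2
    ⟨fun _ => s, fun _ => ⟨η, h1, h, hs⟩, (Set.iUnion_const s).symm⟩

theorem sigmaZero_union [MetrizableSpace X] {s t : Set X} (hs : s ∈ SigmaZero X ξ)
    (ht : t ∈ SigmaZero X ξ) : s ∪ t ∈ SigmaZero X ξ := by
  rw [Set.union_eq_iUnion]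
  exact sigmaZero_iUnion fun b => by cases b <;> assumption

theorem sigmaZero_inter [MetrizableSpace X] {s t : Set X} (hs : s ∈ SigmaZero X ξ)
    (ht : t ∈ SigmaZero X ξ) : s ∩ t ∈ SigmaZero X ξ := by
  rcases le_or_gt ξ 1 with h | h
  · rw [mem_sigmaZero_of_le_one h] at *
    exact hs.inter ht
  · rw [mem_sigmaZero_of_one_lt h] at hs ht
    obtain ⟨f, hf, rfl⟩ := hs
    obtain ⟨g, hg, rfl⟩ := ht
    rw [Set.iUnion_inter_iUnion]
    refine sigmaZero_iUnion fun i => sigmaZero_iUnion fun j => ?_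
    obtain ⟨η, h1, h2, h3⟩ := hf i
    obtain ⟨ζ, h4, h5, h6⟩ := hg j
    refine sigmaZero_of_compl (η := max η ζ) (h1.trans (le_max_left _ _)) (max_lt h2 h5) ?_
    rw [Set.compl_inter]
    exact sigmaZero_union (sigmaZero_mono (le_max_left _ _) h3)
      (sigmaZero_mono (le_max_right _ _) h6)

theorem isClosed_mem_sigmaZero (h : 1 < ξ) {s : Set X} (hs : IsClosed s) : s ∈ SigmaZero X ξ :=
  sigmaZero_of_compl le_rfl h ((mem_sigmaZero_of_le_one le_rfl).2 hs.isOpen_compl)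

theorem iInter_isOpen_mem_sigmaZero [MetrizableSpace X] (h : 3 ≤ ξ) {f : ℕ → Set X}
    (hf : ∀ n, IsOpen (f n)) : ⋂ n, f n ∈ SigmaZero X ξ := by
  have h12 : (1 : Ordinal.{0}) < 2 := by exact_mod_cast Nat.one_lt_two
  have h23 : (2 : Ordinal.{0}) < 3 := by exact_mod_cast Nat.lt_succ_self 2
  refine sigmaZero_of_compl h12.le (h23.trans_le h) ?_
  rw [Set.compl_iInter]
  exact sigmaZero_iUnion fun n => isClosed_mem_sigmaZero h12 (hf n).isClosed_compl

theorem piZero_iInter [MetrizableSpace X] {ι : Type*} [Countable ι] {f : ι → Set X}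
    (hf : ∀ n, f n ∈ PiZero X ξ) : ⋂ n, f n ∈ PiZero X ξ := by
  change (⋂ n, f n)ᶜ ∈ SigmaZero X ξ
  rw [Set.compl_iInter]
  exact sigmaZero_iUnion hf

theorem measurableSet_of_mem_sigmaZero [MeasurableSpace X] [OpensMeasurableSpace X] {s : Set X}
    (hs : s ∈ SigmaZero X ξ) : MeasurableSet s := by
  induction ξ using WellFoundedLT.induction generalizing s with
  | ind ξ ih =>
    rcases le_or_gt ξ 1 with h | h
    · exact ((mem_sigmaZero_of_le_one h).1 hs).measurableSet
    · rw [mem_sigmaZero_of_one_lt h] at hs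
      obtain ⟨g, hg, rfl⟩ := hs
      refine MeasurableSet.iUnion fun n => ?_
      obtain ⟨η, h1, h2, h3⟩ := hg n
      exact (ih η h2 h3).of_compl

/-- A set that coincides with `Σ⁰_ξ` sets on the pieces of a countable `Σ⁰_ξ` cover is `Σ⁰_ξ`. -/
theorem sigmaZero_of_cover [MetrizableSpace X] {ι : Type*} [Countable ι] {M S : ι → Set X}
    {A : Set X} (hM : ∀ i, M i ∈ SigmaZero X ξ) (hcov : ∀ x, ∃ i, x ∈ M i)
    (hS : ∀ i, S i ∈ SigmaZero X ξ) (hA : ∀ i, ∀ x ∈ M i, (x ∈ A ↔ x ∈ S i)) :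
    A ∈ SigmaZero X ξ := by
  have : A = ⋃ i, M i ∩ S i := by
    ext x
    simp only [Set.mem_iUnion, Set.mem_inter_iff]
    constructor
    · intro hx
      obtain ⟨i, hi⟩ := hcov x
      exact ⟨i, hi, (hA i x hi).1 hx⟩
    · rintro ⟨i, hi, hx⟩
      exact (hA i x hi).2 hx
  rw [this]
  exact sigmaZero_iUnion fun i => sigmaZero_inter (hM i) (hS i)

theorem piZero_of_cover [MetrizableSpace X] {ι : Type*} [Countable ι] {M S : ι → Set X}
    {A : Set X} (hM : ∀ i, M i ∈ SigmaZero X ξ) (hcov : ∀ x, ∃ i, x ∈ M i)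
    (hS : ∀ i, S i ∈ PiZero X ξ) (hA : ∀ i, ∀ x ∈ M i, (x ∈ A ↔ x ∈ S i)) :
    A ∈ PiZero X ξ :=
  sigmaZero_of_cover hM hcov hS fun i x hx => not_congr (hA i x hx)

theorem piZero_union [MetrizableSpace X] {s t : Set X} (hs : s ∈ PiZero X ξ)
    (ht : t ∈ PiZero X ξ) : s ∪ t ∈ PiZero X ξ := by
  change (s ∪ t)ᶜ ∈ SigmaZero X ξ
  rw [Set.compl_union]
  exact sigmaZero_inter hs ht

end Hierarchy

theorem countable_Iio_of_card_le {ξ : Ordinal.{0}} (hcount : ξ.card ≤ Cardinal.aleph0) :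
    (Set.Iio ξ).Countable := by
  rw [← Set.countable_coe_iff, ← Cardinal.mk_le_aleph0_iff, Cardinal.mk_Iio_ordinal]
  simpa only [Cardinal.lift_le_aleph0] using hcount

/-- For every countable `ξ` there is a universal `Σ⁰_ξ` set. -/
theorem exists_universal_sigmaZero {ξ : Ordinal.{0}} (hcount : ξ.card ≤ Cardinal.aleph0) :
    ∃ U ∈ SigmaZero (Cantor × Cantor) ξ, ∀ s ∈ SigmaZero Cantor ξ, ∃ c, s = {y | (c, y) ∈ U} := by
  induction ξ using WellFoundedLT.induction with
  | ind ξ ih =>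
    rcases le_or_gt ξ 1 with h | h
    · obtain ⟨b, hbc, -, hb⟩ := exists_countable_basis Cantor
      obtain ⟨e, he⟩ := (hbc.insert ∅).exists_eq_range (Set.insert_nonempty _ _)
      have heo : ∀ n, IsOpen (e n) := fun n => by
        have : e n ∈ insert ∅ b := he ▸ Set.mem_range_self n
        rcases this with h | h
        · rw [h]; exact isOpen_empty
        · exact hb.isOpen h
      refine ⟨⋃ n, {p | p.1 n = 1} ∩ Prod.snd ⁻¹' e n, ?_, fun s hs => ?_⟩
      · rw [mem_sigmaZero_of_le_one h]
        refine isOpen_iUnion fun n => IsOpen.inter ?_ ((heo n).preimage continuous_snd)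
        have hc : Continuous fun p : Cantor × Cantor => p.1 n :=
          (continuous_apply n).comp continuous_fst
        exact (isOpen_discrete ({1} : Set (Fin 2))).preimage hc
      · rw [mem_sigmaZero_of_le_one h] at hs
        classical
        refine ⟨fun n => if e n ⊆ s then 1 else 0, ?_⟩
        ext y
        simp only [Set.mem_ofPred_eq, Set.mem_iUnion, Set.mem_inter_iff, Set.mem_preimage]
        constructor
        · intro hy
          obtain ⟨u, hu, hyu, hus⟩ := hb.exists_subset_of_mem_open hy hs
          obtain ⟨n, rfl⟩ : u ∈ Set.range e := he ▸ Set.mem_insert_of_mem _ hu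
          exact ⟨n, by simp [hus], hyu⟩
        · rintro ⟨n, h1, h2⟩
          by_cases h3 : e n ⊆ s
          · exact h3 h2
          · simp [h3] at h1
    · have hcard : Countable (Set.Ico 1 ξ) := by
        exact (Set.Countable.mono Set.Ico_subset_Iio_self
          (countable_Iio_of_card_le hcount)).to_subtype
      have : Nonempty (Set.Ico 1 ξ) := ⟨⟨1, le_rfl, h⟩⟩
      obtain ⟨e, he⟩ := exists_surjective_nat (Set.Ico 1 ξ)
      choose U hU hUu using fun m => ih (e m).1 (e m).2.2
        ((Ordinal.card_le_card (e m).2.2.le).trans hcount)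
      let π : ℕ → Cantor → Cantor := fun k c i => c (Nat.pair k i)
      have hπ : ∀ k, Continuous (π k) := fun k => continuous_pi fun i => continuous_apply _
      refine ⟨⋃ k : ℕ, (fun p : Cantor × Cantor => (π k p.1, p.2)) ⁻¹' (U k.unpair.2)ᶜ, ?_, ?_⟩
      · refine (mem_sigmaZero_of_one_lt h).2 ⟨_, fun k => ⟨(e k.unpair.2).1, (e k.unpair.2).2.1,
          (e k.unpair.2).2.2, ?_⟩, rfl⟩
        rw [← Set.preimage_compl, compl_compl]
        exact sigmaZero_preimage (((hπ k).comp continuous_fst).prodMk continuous_snd) (hU _)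
      · intro s hs
        obtain ⟨g, hg, rfl⟩ := (mem_sigmaZero_of_one_lt h).1 hs
        choose η h1 h2 h3 using hg
        choose m hm using fun n => he ⟨η n, h1 n, h2 n⟩
        have hc : ∀ k : ℕ, ∃ c : Cantor, {y | (c, y) ∈ U k.unpair.2}ᶜ =
            if m k.unpair.1 = k.unpair.2 then g k.unpair.1 else ∅ := fun k => by
          split_ifs with hk
          · obtain ⟨c, hc⟩ := hUu k.unpair.2 (g k.unpair.1)ᶜ
              (by rw [← hk, hm]; exact h3 _)
            exact ⟨c, by rw [← hc, compl_compl]⟩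
          · obtain ⟨c, hc⟩ := hUu k.unpair.2 Set.univ (isOpen_mem_sigmaZero isOpen_univ)
            exact ⟨c, by rw [← hc, Set.compl_univ]⟩
        choose c hc using hc
        refine ⟨fun j => c j.unpair.1 j.unpair.2, ?_⟩
        have hπc : ∀ k, π k (fun j => c j.unpair.1 j.unpair.2) = c k := fun k => by
          ext i; simp [π]
        ext y
        simp only [Set.mem_iUnion, Set.mem_ofPred_eq, Set.mem_preimage, hπc, Set.mem_compl_iff]
        have hc' : ∀ k, (c k, y) ∉ U k.unpair.2 ↔
            y ∈ (if m k.unpair.1 = k.unpair.2 then g k.unpair.1 else ∅) := fun k => by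
          rw [← hc]; rfl
        simp only [hc']
        constructor
        · rintro ⟨n, hn⟩
          exact ⟨Nat.pair n (m n), by simpa using hn⟩
        · rintro ⟨k, hk⟩
          split_ifs at hk
          · exact ⟨_, hk⟩
          · exact hk.elim

theorem exists_piZero_not_sigmaZero {ξ : Ordinal.{0}} (hcount : ξ.card ≤ Cardinal.aleph0) :
    ∃ D : Set Cantor, D ∈ PiZero Cantor ξ ∧ D ∉ SigmaZero Cantor ξ := by
  obtain ⟨U, hU, hUu⟩ := exists_universal_sigmaZero hcount
  refine ⟨{y | (y, y) ∉ U}, ?_, fun h => ?_⟩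
  · have := sigmaZero_preimage (f := fun y : Cantor => (y, y)) (by fun_prop) hU
    have h2 : {y : Cantor | (y, y) ∉ U}ᶜ = (fun y : Cantor => (y, y)) ⁻¹' U := by
      ext y; simp
    rw [PiZero, Set.mem_ofPred_eq, h2]
    exact this
  · obtain ⟨c, hc⟩ := hUu _ h
    have : c ∈ {y : Cantor | (y, y) ∉ U} ↔ c ∈ {y | (c, y) ∈ U} := by rw [hc]
    simp only [Set.mem_ofPred_eq] at this
    tauto

theorem IsOpen.exists_agree_subset {E : Type*} [TopologicalSpace E] [DiscreteTopology E]
    {U : Set (ℕ → E)} (hU : IsOpen U) {x : ℕ → E} (hx : x ∈ U) :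
    ∃ n, ∀ y : ℕ → E, (∀ i < n, y i = x i) → y ∈ U := by
  obtain ⟨_, ⟨z, n, rfl⟩, hxz, hzU⟩ :=
    (PiNat.isTopologicalBasis_cylinders fun _ : ℕ => E).exists_subset_of_mem_open hx hU
  refine ⟨n, fun y hy => hzU ?_⟩
  rw [PiNat.mem_cylinder_iff] at hxz ⊢
  exact fun i hi => (hy i hi).trans (hxz i hi)

theorem isClopen_agree {E : Type*} [TopologicalSpace E] [DiscreteTopology E] (x : ℕ → E) (n : ℕ) :
    IsClopen {y : ℕ → E | ∀ i < n, y i = x i} := by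
  have h : {y : ℕ → E | ∀ i < n, y i = x i} = ⋂ i ∈ Set.Iio n, {y | y i = x i} := by
    ext y; simp
  rw [h]
  refine (Set.finite_Iio n).isClopen_biInter fun i _ => ?_
  exact (isClopen_discrete {x i}).preimage (continuous_apply i)

/-- A countable certificate, relative to a parametrization `h`, showing that the section at `α`
is not `Σ⁰_ξ`; the sequence `o` enumerates the ordinals of `[1, ξ]`. -/
structure IsCertificate (h : (ℕ → ℕ) → Cantor × Cantor × Bool) (o : ℕ → Ordinal.{0})
    (ξ : Ordinal.{0}) (α : Cantor) (w : ℕ → ℕ → ℕ) (k : ℕ → ℕ) (le : ℕ → ℕ → Prop)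
    (tri : ℕ → ℕ → ℕ → Prop) : Prop where
  fst_eq : ∀ p, (h (w p)).1 = α
  refl : ∀ p, le p p
  trans : ∀ p q r, le p q → le q r → le p r
  mono : ∀ p q, le p q → k q ≤ k p
  agree : ∀ p q, le p q → ∀ i, i < k q → w p i = w q i
  agree_snd : ∀ p q, le p q → ∀ i, i < k q → (h (w p)).2.1 i = (h (w q)).2.1 i
  label : ∀ p q, le p q → (h (w p)).2.2 = (h (w q)).2.2
  extend : ∀ p, ∃ q, le q p ∧ k p < k q
  tri_mono : ∀ i p p' q, le p' p → tri i p q → tri i p' q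
  tri_step : ∀ i j p q, tri i p q → o j < o i → ∃ q', le q' q ∧ tri j q' p
  tri_one : ∀ i p q, o i = 1 → tri i p q → ∃ q', le q' q ∧ k p ≤ k q' ∧
    ∀ j, j < k p → (h (w q')).2.1 j = (h (w p)).2.1 j
  top : ∃ p q, (h (w p)).2.2 = true ∧ (h (w q)).2.2 = false ∧ ∀ i, o i = ξ → tri i p q

namespace IsCertificate

variable {h : (ℕ → ℕ) → Cantor × Cantor × Bool} {o : ℕ → Ordinal.{0}}
    {ξ : Ordinal.{0}} {α : Cantor} {w : ℕ → ℕ → ℕ} {k : ℕ → ℕ} {le : ℕ → ℕ → Prop}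
    {tri : ℕ → ℕ → ℕ → Prop}

/-- The space of strictly refining descending sequences of conditions. -/
def Branches (k : ℕ → ℕ) (le : ℕ → ℕ → Prop) : Set (ℕ → ℕ) :=
  {x | ∀ n, le (x (n + 1)) (x n) ∧ k (x n) < k (x (n + 1))}

theorem isClosed_branches : IsClosed (Branches k le) := by
  have : Branches k le = ⋂ n, {x | le (x (n + 1)) (x n) ∧ k (x n) < k (x (n + 1))} := by
    ext x; simp [Branches]
  rw [this]
  refine isClosed_iInter fun n => ?_
  have hc : Continuous fun x : ℕ → ℕ => (x (n + 1), x n) :=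
    (continuous_apply _).prodMk (continuous_apply _)
  exact (isClosed_discrete {p : ℕ × ℕ | le p.1 p.2 ∧ k p.2 < k p.1}).preimage hc

theorem branch_le (H : IsCertificate h o ξ α w k le tri) {x : ℕ → ℕ} (hx : x ∈ Branches k le)
    {m n : ℕ} (hmn : n ≤ m) : le (x m) (x n) := by
  induction m, hmn using Nat.le_induction with
  | base => exact H.refl _
  | succ m _ ih => exact H.trans _ _ _ (hx m).1 ih

theorem le_branch {x : ℕ → ℕ} (hx : x ∈ Branches k le) (n : ℕ) : n ≤ k (x n) := by
  induction n with
  | zero => exact Nat.zero_le _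
  | succ n ih => exact ih.trans_lt (hx n).2

/-- The limit of the points of a branch. -/
def limit (w : ℕ → ℕ → ℕ) (x : ℕ → ℕ) : ℕ → ℕ := fun i => w (x (i + 1)) i

theorem continuous_limit : Continuous (limit w) :=
  continuous_pi fun i => (continuous_of_discreteTopology (f := fun p : ℕ => w p i)).comp
    (continuous_apply (i + 1))

theorem limit_agree (H : IsCertificate h o ξ α w k le tri) {x : ℕ → ℕ} (hx : x ∈ Branches k le)
    {n i : ℕ} (hi : i < k (x n)) : limit w x i = w (x n) i := by
  have h1 := H.agree _ _ (H.branch_le hx (le_max_left (i + 1) n)) i (le_branch hx (i + 1))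
  have h2 := H.agree _ _ (H.branch_le hx (le_max_right (i + 1) n)) i hi
  exact h1.symm.trans h2

theorem tendsto_limit (H : IsCertificate h o ξ α w k le tri) {x : ℕ → ℕ}
    (hx : x ∈ Branches k le) :
    Filter.Tendsto (fun n => w (x n)) Filter.atTop (𝓝 (limit w x)) := by
  rw [tendsto_pi_nhds]
  intro i
  refine tendsto_const_nhds.congr' ?_
  filter_upwards [Filter.eventually_gt_atTop i] with n hn
  exact H.limit_agree hx (hn.trans_le (le_branch hx n))

theorem limit_mem (hc : Continuous h) (H : IsCertificate h o ξ α w k le tri) {x : ℕ → ℕ}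
    (hx : x ∈ Branches k le) {C : Set (Cantor × Cantor × Bool)} (hC : IsClosed C) (n : ℕ)
    (hn : ∀ m, n ≤ m → h (w (x m)) ∈ C) : h (limit w x) ∈ C := by
  refine hC.mem_of_tendsto ((hc.tendsto _).comp (H.tendsto_limit hx)) ?_
  filter_upwards [Filter.eventually_ge_atTop n] with m hm
  exact hn m hm

theorem limit_fst (hc : Continuous h) (H : IsCertificate h o ξ α w k le tri) {x : ℕ → ℕ}
    (hx : x ∈ Branches k le) : (h (limit w x)).1 = α :=
  H.limit_mem hc hx (C := {c | c.1 = α}) (isClosed_eq continuous_fst continuous_const) 0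
    fun _ _ => H.fst_eq _

theorem limit_label (hc : Continuous h) (H : IsCertificate h o ξ α w k le tri) {x : ℕ → ℕ}
    (hx : x ∈ Branches k le) : (h (limit w x)).2.2 = (h (w (x 0))).2.2 :=
  H.limit_mem hc hx (C := {c | c.2.2 = (h (w (x 0))).2.2})
    (isClosed_eq (by fun_prop) continuous_const) 0
    fun m hm => H.label _ _ (H.branch_le hx hm)

theorem limit_snd (hc : Continuous h) (H : IsCertificate h o ξ α w k le tri) {x : ℕ → ℕ}
    (hx : x ∈ Branches k le) (n : ℕ) {i : ℕ} (hi : i < k (x n)) :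
    (h (limit w x)).2.1 i = (h (w (x n))).2.1 i :=
  H.limit_mem hc hx (C := {c | c.2.1 i = (h (w (x n))).2.1 i})
    (isClosed_eq ((continuous_apply i).comp (continuous_fst.comp continuous_snd))
      continuous_const) n
    fun _ hm => H.agree_snd _ _ (H.branch_le hx hm) i hi

theorem exists_branch (H : IsCertificate h o ξ α w k le tri) {u : ℕ → ℕ}
    (hu : u ∈ Branches k le) (m : ℕ) {q : ℕ} (hq : le q (u m)) :
    ∃ v ∈ Branches k le, (∀ i < m + 1, v i = u i) ∧ le (v (m + 1)) q ∧ k q ≤ k (v (m + 1)) := by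
  choose f hf hfk using H.extend
  refine ⟨fun i => if i < m + 1 then u i else f^[i - m] q, ?_, ?_, ?_⟩
  · intro n
    rcases lt_trichotomy n m with hn | rfl | hn
    · have h1 : n < m + 1 := by omega
      simpa [hn, h1] using hu n
    · simpa using ⟨H.trans _ _ _ (hf q) hq, (H.mono _ _ hq).trans_lt (hfk q)⟩
    · have h1 : ¬ n < m + 1 := by omega
      have h2 : ¬ n + 1 < m + 1 := by omega
      have h3 : n + 1 - m = (n - m) + 1 := by omega
      simp only [h1, h2, h3, if_false, Function.iterate_succ_apply']
      exact ⟨hf _, hfk _⟩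
  · intro i hi
    simp [hi]
  · simpa using ⟨hf q, (hfk q).le⟩

theorem exists_branch_zero (H : IsCertificate h o ξ α w k le tri) (q : ℕ) :
    ∃ v ∈ Branches k le, v 0 = q := by
  choose f hf hfk using H.extend
  refine ⟨fun i => f^[i] q, fun n => ?_, rfl⟩
  simp only [Function.iterate_succ_apply']
  exact ⟨hf _, hfk _⟩

theorem residual_transfer (hc : Continuous h) (H : IsCertificate h o ξ α w k le tri)
    (ho : ∀ ζ, 1 ≤ ζ → ζ ≤ ξ → ∃ i, o i = ζ) (ζ : Ordinal.{0}) (h1 : 1 ≤ ζ) (hζ : ζ ≤ ξ) (i : ℕ)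
    (hi : o i = ζ) (x u : ℕ → ℕ) (hx : x ∈ Branches k le) (hu : u ∈ Branches k le) (n m : ℕ)
    (htri : tri i (x n) (u m)) (S : Set Cantor) (hS : S ∈ PiZero Cantor ζ)
    (hres : ∀ᶠ z : Branches k le in residual _, (∀ i < m + 1, z.1 i = u i) →
      (h (limit w z)).2.1 ∈ S) :
    ∀ᶠ z : Branches k le in residual _, (∀ i < n + 1, z.1 i = x i) →
      (h (limit w z)).2.1 ∈ S := by
  induction ζ using WellFoundedLT.induction generalizing i x u n m S with
  | ind ζ ih =>
  have : PolishSpace (Branches k le) := isClosed_branches.polishSpace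
  have hcy : Continuous fun z : Branches k le => (h (limit w z)).2.1 :=
    continuous_fst.comp (continuous_snd.comp
      (hc.comp (continuous_limit.comp continuous_subtype_val)))
  have hopen : ∀ (v : ℕ → ℕ) (l : ℕ), IsOpen {z : Branches k le | ∀ i < l, z.1 i = v i} :=
    fun v l => (isClopen_agree v l).isOpen.preimage continuous_subtype_val
  rcases h1.eq_or_lt with rfl | h1'
  · refine Filter.Eventually.of_forall fun z hz => ?_
    by_contra hzS
    obtain ⟨N, hN⟩ := IsOpen.exists_agree_subset
      ((mem_sigmaZero_of_le_one le_rfl).1 hS : IsOpen Sᶜ) (x := (h (limit w z)).2.1) hzS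
    have hle : le (z.1 (max n N)) (x n) := by
      rw [← hz n (Nat.lt_succ_self n)]
      exact H.branch_le z.2 (le_max_left _ _)
    obtain ⟨q', hq', hk, hag⟩ := H.tri_one i _ _ hi (H.tri_mono _ _ _ _ hle htri)
    obtain ⟨v, hv, hvu, hvq, hkv⟩ := H.exists_branch hu m hq'
    obtain ⟨z', hz'⟩ := (dense_of_mem_residual hres).inter_open_nonempty _ (hopen v (m + 2))
      ⟨⟨v, hv⟩, fun i _ => rfl⟩
    have hz'u := hz'.2 fun j hj => (hz'.1 j (by omega)).trans (hvu j hj)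
    refine hN _ (fun j hj => ?_) hz'u
    have hjk : j < k (z.1 (max n N)) :=
      hj.trans_le ((le_max_right n N).trans (le_branch z.2 _))
    have hz'v : z'.1 (m + 1) = v (m + 1) := hz'.1 _ (by omega)
    rw [H.limit_snd hc z.2 (max n N) hjk, ← hag j hjk, ← H.agree_snd _ _ hvq j (hjk.trans_le hk),
      ← hz'v]
    exact H.limit_snd hc z'.2 (m + 1) (by rw [hz'v]; exact hjk.trans_le (hk.trans hkv))
  · obtain ⟨f, hf, hfS⟩ := (mem_sigmaZero_of_one_lt h1').1 hS
    by_contra hcon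
    have hex : ∃ l, ¬ ∀ᶠ z : Branches k le in residual _, ¬ ((∀ i < n + 1, z.1 i = x i) ∧
        (h (limit w z)).2.1 ∈ f l) := by
      by_contra! hall
      refine hcon ((eventually_countable_forall.2 hall).mono fun z hz hzx => ?_)
      by_contra hzS
      obtain ⟨l, hl⟩ := Set.mem_iUnion.1 (hfS ▸ (show _ ∈ Sᶜ from hzS))
      exact hz l hzx hl
    obtain ⟨l, hl⟩ := hex
    obtain ⟨η, hη1, hηζ, hη⟩ := hf l
    have hmeas : MeasurableSet {z : Branches k le | (∀ i < n + 1, z.1 i = x i) ∧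
        (h (limit w z)).2.1 ∈ f l} :=
      (hopen x (n + 1)).measurableSet.inter
        ((measurableSet_of_mem_sigmaZero hη).of_compl.preimage hcy.measurable)
    obtain ⟨U, hU, hUe⟩ := hmeas.residualEq_isOpen
    have hne : ∃ z ∈ U, ∀ i < n + 1, z.1 i = x i := by
      by_contra! hno
      refine hl (hUe.mono fun z hz hz2 => ?_)
      obtain ⟨i, hi, hne⟩ := hno z (hz.mp hz2)
      exact hne (hz2.1 i hi)
    obtain ⟨z, hzU, hzx⟩ := hne
    obtain ⟨V, hV, rfl⟩ := isOpen_induced_iff.1 hU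
    obtain ⟨N, hN⟩ := hV.exists_agree_subset hzU
    obtain ⟨j, hj⟩ := ho η hη1 (hηζ.le.trans hζ)
    have hle : le (z.1 (max n N)) (x n) := by
      rw [← hzx n (Nat.lt_succ_self n)]
      exact H.branch_le z.2 (le_max_left _ _)
    obtain ⟨q', hq', htri'⟩ := H.tri_step i j _ _ (H.tri_mono _ _ _ _ hle htri)
      (by rw [hi, hj]; exact hηζ)
    obtain ⟨v, hv, hvu, hvq, hkv⟩ := H.exists_branch hu m hq'
    have hres' := ih η hηζ hη1 (hηζ.le.trans hζ) j hj v z.1 hv z.2 (m + 1) (max n N)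
      (H.tri_mono _ _ _ _ hvq htri') (f l) hη (hUe.mono fun z' hz' hagr =>
        (hz'.mpr (hN _ fun i hi => hagr i
          (hi.trans_le ((le_max_right n N).trans (Nat.le_succ _))))).2)
    obtain ⟨z', hz'⟩ := (dense_of_mem_residual (hres.and hres')).inter_open_nonempty _
      (hopen v (m + 2)) ⟨⟨v, hv⟩, fun i _ => rfl⟩
    have hS' := hz'.2.1 fun j hj => (hz'.1 j (by omega)).trans (hvu j hj)
    have hf' := hz'.2.2 fun j hj => hz'.1 j (by omega)
    have : (h (limit w z')).2.1 ∈ Sᶜ := hfS ▸ Set.mem_iUnion.2 ⟨l, hf'⟩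
    exact this hS'

theorem not_mem_sigmaZero (hc : Continuous h) (H : IsCertificate h o ξ α w k le tri)
    (ho : ∀ ζ, 1 ≤ ζ → ζ ≤ ξ → ∃ i, o i = ζ) (hξ : 1 ≤ ξ) {B : Set (Cantor × Cantor)}
    (hB : ∀ v, (h v).2.2 = true ↔ ((h v).1, (h v).2.1) ∈ B) :
    {β | (α, β) ∈ B} ∉ SigmaZero Cantor ξ := by
  intro hS
  have : PolishSpace (Branches k le) := isClosed_branches.polishSpace
  obtain ⟨p, q, hp, hq, htri⟩ := H.top
  obtain ⟨i, hi⟩ := ho ξ hξ le_rfl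
  obtain ⟨x, hx, rfl⟩ := H.exists_branch_zero p
  obtain ⟨u, hu, rfl⟩ := H.exists_branch_zero q
  have key : ∀ z : Branches k le, (h (limit w z)).2.2 = true ↔
      (h (limit w z)).2.1 ∈ {β | (α, β) ∈ B} := fun z => by
    rw [hB, H.limit_fst hc z.2]; rfl
  have hres := H.residual_transfer hc ho ξ hξ le_rfl i hi x u hx hu 0 0 (htri i hi)
    {β | (α, β) ∈ B}ᶜ (by rw [PiZero, Set.mem_ofPred_eq, compl_compl]; exact hS)
    (Filter.Eventually.of_forall fun z hz => by
      rw [Set.mem_compl_iff, ← key, H.limit_label hc z.2, hz 0 Nat.zero_lt_one, hq]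
      exact Bool.false_ne_true)
  have hopen : IsOpen {z : Branches k le | ∀ i < 0 + 1, z.1 i = x i} :=
    (isClopen_agree x 1).isOpen.preimage continuous_subtype_val
  obtain ⟨z, hz, hz2⟩ := (dense_of_mem_residual hres).inter_open_nonempty _ hopen
    ⟨⟨x, hx⟩, fun i _ => rfl⟩
  have h1 := hz2 hz
  rw [Set.mem_compl_iff, ← key, H.limit_label hc z.2, hz 0 Nat.zero_lt_one] at h1
  exact h1 hp

end IsCertificate

/-- A set together with a σ-ideal not containing it, the set being homogeneous up to `size`. -/
structure Condition (h : (ℕ → ℕ) → Cantor × Cantor × Bool) (α : Cantor) where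
  carrier : Set (ℕ → ℕ)
  ideal : Set (Set (ℕ → ℕ))
  size : ℕ
  fst_eq : ∀ v ∈ carrier, (h v).1 = α
  ideal_mono : ∀ Z Z', Z ⊆ Z' → Z' ∈ ideal → Z ∈ ideal
  ideal_empty : ∅ ∈ ideal
  ideal_iUnion : ∀ Z : ℕ → Set (ℕ → ℕ), (∀ n, Z n ∈ ideal) → ⋃ n, Z n ∈ ideal
  notMem : carrier ∉ ideal
  agree : ∀ v ∈ carrier, ∀ v' ∈ carrier, ∀ i < size, v i = v' i
  agree_snd : ∀ v ∈ carrier, ∀ v' ∈ carrier, ∀ i < size, (h v).2.1 i = (h v').2.1 i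
  label : ∀ v ∈ carrier, ∀ v' ∈ carrier, (h v).2.2 = (h v').2.2

namespace Condition

variable {h : (ℕ → ℕ) → Cantor × Cantor × Bool} {α : Cantor}

theorem nonempty (c : Condition h α) : c.carrier.Nonempty := by
  rw [Set.nonempty_iff_ne_empty]
  intro h0
  exact c.notMem (h0 ▸ c.ideal_empty)

/-- A chosen point of the carrier. -/
noncomputable def point (c : Condition h α) : ℕ → ℕ := c.nonempty.some

theorem point_mem (c : Condition h α) : c.point ∈ c.carrier := c.nonempty.some_mem

/-- Refinement of conditions. -/
def Le (c d : Condition h α) : Prop :=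
  c.carrier ⊆ d.carrier ∧ d.ideal ⊆ c.ideal ∧ d.size ≤ c.size

theorem Le.refl (c : Condition h α) : c.Le c := ⟨subset_rfl, subset_rfl, le_rfl⟩

theorem Le.trans {c d e : Condition h α} (h1 : c.Le d) (h2 : d.Le e) : c.Le e :=
  ⟨h1.1.trans h2.1, h2.2.1.trans h1.2.1, h2.2.2.trans h1.2.2⟩

/-- Every `Σ⁰_η` set that is negligible for `d` is negligible for `c`. -/
def Dominated (η : Ordinal.{0}) (c d : Condition h α) : Prop :=
  ∀ S ∈ SigmaZero Cantor η, {v ∈ d.carrier | (h v).2.1 ∈ S} ∈ d.ideal →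
    {v ∈ c.carrier | (h v).2.1 ∈ S} ∈ c.ideal

theorem Dominated.mono {η : Ordinal.{0}} {c c' d : Condition h α} (hc : c'.Le c)
    (hd : Dominated η c d) : Dominated η c' d := by
  intro S hS hd'
  refine hc.2.1 (c.ideal_mono _ _ ?_ (hd S hS hd'))
  exact fun v hv => ⟨hc.1 hv.1, hv.2⟩

theorem ideal_union (c : Condition h α) {Z Z' : Set (ℕ → ℕ)} (hZ : Z ∈ c.ideal)
    (hZ' : Z' ∈ c.ideal) : Z ∪ Z' ∈ c.ideal := by
  refine c.ideal_mono _ _ ?_ (c.ideal_iUnion (fun n => if n = 0 then Z else Z') fun n => ?_)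
  · rintro v (hv | hv)
    · exact Set.mem_iUnion.2 ⟨0, by simpa using hv⟩
    · exact Set.mem_iUnion.2 ⟨1, by simpa using hv⟩
  · split_ifs <;> assumption

theorem exists_le_of_subset (d : Condition h α) {Z : Set (ℕ → ℕ)} (hZd : Z ⊆ d.carrier)
    (hZ : Z ∉ d.ideal) {l : ℕ} (hl : d.size ≤ l) :
    ∃ d' : Condition h α, d'.Le d ∧ d'.carrier ⊆ Z ∧ d'.size = l := by
  let F : (Fin l → ℕ) × (Fin l → Fin 2) → Set (ℕ → ℕ) := fun p =>
    {v ∈ Z | (∀ i : Fin l, v i = p.1 i) ∧ ∀ i : Fin l, (h v).2.1 i = p.2 i}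
  have hF : ∃ p, F p ∉ d.ideal := by
    by_contra! hall
    obtain ⟨e, he⟩ := exists_surjective_nat ((Fin l → ℕ) × (Fin l → Fin 2))
    refine hZ (d.ideal_mono _ _ (fun v hv => ?_) (d.ideal_iUnion (fun n => F (e n))
      fun n => hall _))
    obtain ⟨n, hn⟩ := he (fun i => v i, fun i => (h v).2.1 i)
    refine Set.mem_iUnion.2 ⟨n, hv, fun i => ?_, fun i => ?_⟩ <;> rw [hn]
  obtain ⟨p, hp⟩ := hF
  refine ⟨⟨F p, d.ideal, l, fun v hv => d.fst_eq v (hZd hv.1), d.ideal_mono, d.ideal_empty,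
    d.ideal_iUnion, hp, fun v hv v' hv' i hi => ?_, fun v hv v' hv' i hi => ?_,
    fun v hv v' hv' => d.label v (hZd hv.1) v' (hZd hv'.1)⟩,
    ⟨fun v hv => hZd hv.1, subset_rfl, hl⟩, fun v hv => hv.1, rfl⟩
  · exact (hv.2.1 ⟨i, hi⟩).trans (hv'.2.1 ⟨i, hi⟩).symm
  · exact (hv.2.2 ⟨i, hi⟩).trans (hv'.2.2 ⟨i, hi⟩).symm

theorem exists_extend (d : Condition h α) : ∃ d' : Condition h α, d'.Le d ∧ d.size < d'.size := by
  obtain ⟨d', h1, -, h2⟩ := d.exists_le_of_subset subset_rfl d.notMem (Nat.le_succ _)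
  exact ⟨d', h1, by omega⟩

theorem exists_step {ζ η : Ordinal.{0}} (h1 : 1 ≤ ζ) (hζ : ζ < η) {c d : Condition h α}
    (hcd : Dominated η c d) : ∃ d' : Condition h α, d'.Le d ∧ Dominated ζ d' c := by
  let J : Set (Set (ℕ → ℕ)) := {Z | ∃ S ∈ SigmaZero Cantor ζ,
    {v ∈ c.carrier | (h v).2.1 ∈ S} ∈ c.ideal ∧ {v ∈ Z | (h v).2.1 ∉ S} ∈ d.ideal}
  have hJ : d.ideal ⊆ J := fun Z hZ => ⟨∅, isOpen_mem_sigmaZero isOpen_empty,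
    by simpa using c.ideal_empty, by simpa using hZ⟩
  refine ⟨⟨d.carrier, J, d.size, d.fst_eq, ?_, hJ d.ideal_empty, ?_, ?_, d.agree, d.agree_snd,
    d.label⟩, ⟨subset_rfl, hJ, le_rfl⟩, ?_⟩
  · rintro Z Z' hZ ⟨S, hS, hS1, hS2⟩
    refine ⟨S, hS, hS1, d.ideal_mono _ _ ?_ hS2⟩
    exact fun v hv => ⟨hZ hv.1, hv.2⟩
  · intro Z hZ
    choose S hS hS1 hS2 using hZ
    refine ⟨⋃ n, S n, sigmaZero_iUnion hS, ?_, ?_⟩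
    · refine c.ideal_mono _ _ ?_ (c.ideal_iUnion _ hS1)
      rintro v ⟨hv, hvS⟩
      obtain ⟨n, hn⟩ := Set.mem_iUnion.1 hvS
      exact Set.mem_iUnion.2 ⟨n, hv, hn⟩
    · refine d.ideal_mono _ _ ?_ (d.ideal_iUnion _ hS2)
      rintro v ⟨hv, hvS⟩
      obtain ⟨n, hn⟩ := Set.mem_iUnion.1 hv
      exact Set.mem_iUnion.2 ⟨n, hn, fun hh => hvS (Set.mem_iUnion.2 ⟨n, hh⟩)⟩
  · rintro ⟨S, hS, hS1, hS2⟩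
    have := hcd Sᶜ (sigmaZero_of_compl h1 hζ (by rwa [compl_compl])) hS2
    refine c.notMem (c.ideal_mono _ _ (fun v hv => ?_) (c.ideal_union hS1 this))
    by_cases hvS : (h v).2.1 ∈ S
    · exact Or.inl ⟨hv, hvS⟩
    · exact Or.inr ⟨hv, hvS⟩
  · intro S hS hSc
    refine ⟨S, hS, hSc, d.ideal_mono _ _ ?_ d.ideal_empty⟩
    rintro v ⟨hv, hvS⟩
    exact (hvS hv.2).elim

theorem exists_one {c d : Condition h α} (hcd : Dominated 1 c d) :
    ∃ d' : Condition h α, d'.Le d ∧ c.size ≤ d'.size ∧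
      ∀ j < c.size, (h d'.point).2.1 j = (h c.point).2.1 j := by
  have hN : {v ∈ d.carrier | (h v).2.1 ∈
      {y : Cantor | ∀ j < c.size, y j = (h c.point).2.1 j}} ∉ d.ideal := by
    intro hd
    have := hcd _ (isOpen_mem_sigmaZero (isClopen_agree _ _).isOpen) hd
    refine c.notMem (c.ideal_mono _ _ ?_ this)
    exact fun v hv => ⟨hv, c.agree_snd v hv _ c.point_mem⟩
  obtain ⟨d', h1, h2, h3⟩ := d.exists_le_of_subset (fun v hv => hv.1) hN
    (le_max_left d.size c.size)
  exact ⟨d', h1, by omega, (h2 d'.point_mem).2⟩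

theorem exists_top {B : Set (Cantor × Cantor)}
    (hB : ∀ v, (h v).2.2 = true ↔ ((h v).1, (h v).2.1) ∈ B)
    (hsurj : ∀ y, ∃ v, (h v).1 = α ∧ (h v).2.1 = y) {ξ : Ordinal.{0}}
    (hα : {β | (α, β) ∈ B} ∉ SigmaZero Cantor ξ) :
    ∃ c d : Condition h α, (h c.point).2.2 = true ∧ (h d.point).2.2 = false ∧
      Dominated ξ c d := by
  have hB' : ∀ v, (h v).1 = α → ((h v).2.2 = true ↔ (h v).2.1 ∈ {β | (α, β) ∈ B}) :=
    fun v hv => by rw [hB, hv]; rfl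
  let I : Set (Set (ℕ → ℕ)) := {Z | ∃ S ∈ SigmaZero Cantor ξ, S ⊆ {β | (α, β) ∈ B} ∧
    ∀ v ∈ Z, (h v).2.1 ∈ S}
  let c : Condition h α := ⟨{v | (h v).1 = α ∧ (h v).2.2 = true}, I, 0, fun v hv => hv.1,
    fun Z Z' hZ ⟨S, hS, hS1, hS2⟩ => ⟨S, hS, hS1, fun v hv => hS2 v (hZ hv)⟩,
    ⟨∅, isOpen_mem_sigmaZero isOpen_empty, Set.empty_subset _, fun v hv => hv.elim⟩,
    fun Z hZ => by
      choose S hS hS1 hS2 using hZ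
      refine ⟨⋃ n, S n, sigmaZero_iUnion hS, Set.iUnion_subset hS1, fun v hv => ?_⟩
      obtain ⟨n, hn⟩ := Set.mem_iUnion.1 hv
      exact Set.mem_iUnion.2 ⟨n, hS2 n v hn⟩,
    by
      rintro ⟨S, hS, hS1, hS2⟩
      refine hα ((hS1.antisymm fun y hy => ?_) ▸ hS)
      obtain ⟨v, hv, rfl⟩ := hsurj y
      exact hS2 v ⟨hv, (hB' v hv).2 hy⟩,
    fun _ _ _ _ i hi => (Nat.not_lt_zero i hi).elim,
    fun _ _ _ _ i hi => (Nat.not_lt_zero i hi).elim,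
    fun v hv v' hv' => hv.2.trans hv'.2.symm⟩
  let d : Condition h α := ⟨{v | (h v).1 = α ∧ (h v).2.2 = false}, {∅}, 0, fun v hv => hv.1,
    fun Z Z' hZ hZ' => Set.subset_empty_iff.1 (hZ.trans (Set.mem_singleton_iff.1 hZ').subset),
    rfl, fun Z hZ => Set.iUnion_eq_empty.2 hZ,
    by
      intro hd
      suffices hu : {β | (α, β) ∈ B} = Set.univ from hα (hu ▸ isOpen_mem_sigmaZero isOpen_univ)
      refine Set.eq_univ_of_forall fun y => ?_
      obtain ⟨v, hv, rfl⟩ := hsurj y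
      refine (hB' v hv).1 ?_
      by_contra hf
      have : v ∈ (∅ : Set (ℕ → ℕ)) :=
        Set.mem_singleton_iff.1 hd ▸ ⟨hv, Bool.eq_false_iff.2 hf⟩
      exact this,
    fun _ _ _ _ i hi => (Nat.not_lt_zero i hi).elim,
    fun _ _ _ _ i hi => (Nat.not_lt_zero i hi).elim,
    fun v hv v' hv' => hv.2.trans hv'.2.symm⟩
  refine ⟨c, d, c.point_mem.2, d.point_mem.2, fun S hS hSd => ⟨S, hS, fun y hy => ?_,
    fun v hv => hv.2⟩⟩
  obtain ⟨v, hv, rfl⟩ := hsurj y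
  refine (hB' v hv).1 ?_
  by_contra hf
  have : v ∈ (∅ : Set (ℕ → ℕ)) :=
    Set.mem_singleton_iff.1 hSd ▸ ⟨⟨hv, Bool.eq_false_iff.2 hf⟩, hy⟩
  exact this

end Condition

/-- Closing off a countable set under countably many binary operations. -/
theorem exists_countable_closed {Q ι : Type*} [Countable ι] (F : ι → Q → Q → Q) {C₀ : Set Q}
    (h₀ : C₀.Countable) : ∃ C : Set Q, C.Countable ∧ C₀ ⊆ C ∧
      ∀ i, ∀ p ∈ C, ∀ q ∈ C, F i p q ∈ C := by
  let C : ℕ → Set Q := fun n => Nat.rec C₀ (fun _ D => D ∪ ⋃ i, Set.image2 (F i) D D) n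
  have hmono : Monotone C := monotone_nat_of_le_succ fun n => Set.subset_union_left
  refine ⟨⋃ n, C n, Set.countable_iUnion fun n => ?_, Set.subset_iUnion C 0, ?_⟩
  · induction n with
    | zero => exact h₀
    | succ n ih => exact ih.union (Set.countable_iUnion fun i => ih.image2 ih _)
  · intro i p hp q hq
    obtain ⟨m, hm⟩ := Set.mem_iUnion.1 hp
    obtain ⟨n, hn⟩ := Set.mem_iUnion.1 hq
    refine Set.mem_iUnion.2 ⟨max m n + 1, Or.inr (Set.mem_iUnion.2 ⟨i, ?_⟩)⟩
    exact Set.mem_image2_of_mem (hmono (le_max_left m n) hm) (hmono (le_max_right m n) hn)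

theorem exists_isCertificate {h : (ℕ → ℕ) → Cantor × Cantor × Bool} {α : Cantor}
    {B : Set (Cantor × Cantor)} (hB : ∀ v, (h v).2.2 = true ↔ ((h v).1, (h v).2.1) ∈ B)
    (hsurj : ∀ y, ∃ v, (h v).1 = α ∧ (h v).2.1 = y) {ξ : Ordinal.{0}}
    (hα : {β | (α, β) ∈ B} ∉ SigmaZero Cantor ξ) (o : ℕ → Ordinal.{0}) (ho : ∀ i, 1 ≤ o i) :
    ∃ w k le tri, IsCertificate h o ξ α w k le tri := by
  classical
  obtain ⟨c₀, d₀, hc₀, hd₀, hcd₀⟩ := Condition.exists_top hB hsurj hα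
  choose f hf hfk using Condition.exists_extend (h := h) (α := α)
  have hg : ∀ i j (c d : Condition h α), ∃ d' : Condition h α, c.Dominated (o i) d →
      o j < o i → d'.Le d ∧ d'.Dominated (o j) c := fun i j c d => by
    by_cases hh : c.Dominated (o i) d ∧ o j < o i
    · obtain ⟨d', hd'⟩ := Condition.exists_step (ho j) hh.2 hh.1
      exact ⟨d', fun _ _ => hd'⟩
    · exact ⟨d, fun h1 h2 => (hh ⟨h1, h2⟩).elim⟩
  choose g hg using hg
  have hu : ∀ (c d : Condition h α), ∃ d' : Condition h α, c.Dominated 1 d →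
      d'.Le d ∧ c.size ≤ d'.size ∧
      ∀ j < c.size, (h d'.point).2.1 j = (h c.point).2.1 j := fun c d => by
    by_cases hh : c.Dominated 1 d
    · obtain ⟨d', hd'⟩ := Condition.exists_one hh
      exact ⟨d', fun _ => hd'⟩
    · exact ⟨d, fun h1 => (hh h1).elim⟩
  choose u hu using hu
  let F : Option (Option (ℕ × ℕ)) → Condition h α → Condition h α → Condition h α := fun i =>
    match i with
    | none => fun c _ => f c
    | some none => u
    | some (some (i, j)) => g i j
  obtain ⟨C, hC, hC0, hCF⟩ := exists_countable_closed F (Set.toFinite {c₀, d₀}).countable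
  obtain ⟨e, rfl⟩ := hC.exists_eq_range ⟨c₀, hC0 (by simp)⟩
  have hex : ∀ {c}, c ∈ Set.range e → ∃ p, e p = c := fun hc => hc
  refine ⟨fun p => (e p).point, fun p => (e p).size, fun p q => (e p).Le (e q),
    fun i p q => (e p).Dominated (o i) (e q), ?_⟩
  constructor
  · exact fun p => (e p).fst_eq _ (e p).point_mem
  · exact fun p => .refl _
  · exact fun p q r => .trans
  · exact fun p q hpq => hpq.2.2
  · exact fun p q hpq i hi => (e q).agree _ (hpq.1 (e p).point_mem) _ (e q).point_mem i hi
  · exact fun p q hpq i hi => (e q).agree_snd _ (hpq.1 (e p).point_mem) _ (e q).point_mem i hi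
  · exact fun p q hpq => (e q).label _ (hpq.1 (e p).point_mem) _ (e q).point_mem
  · intro p
    obtain ⟨q, hq⟩ := hex (hCF none (e p) ⟨p, rfl⟩ (e p) ⟨p, rfl⟩)
    exact ⟨q, hq ▸ hf _, by rw [hq]; exact hfk _⟩
  · exact fun i p p' q hp => .mono hp
  · intro i j p q hpq hji
    obtain ⟨q', hq'⟩ := hex (hCF (some (some (i, j))) (e p) ⟨p, rfl⟩ (e q) ⟨q, rfl⟩)
    exact ⟨q', by rw [hq']; exact hg i j _ _ hpq hji⟩
  · intro i p q hi hpq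
    obtain ⟨q', hq'⟩ := hex (hCF (some none) (e p) ⟨p, rfl⟩ (e q) ⟨q, rfl⟩)
    rw [hi] at hpq
    exact ⟨q', by rw [hq']; exact hu _ _ hpq⟩
  · obtain ⟨p, hp⟩ := hex (hC0 (show c₀ ∈ _ by simp))
    obtain ⟨q, hq⟩ := hex (hC0 (show d₀ ∈ _ by simp))
    exact ⟨p, q, by rw [hp, hc₀], by rw [hq, hd₀], fun i hi => by rw [hp, hq, hi]; exact hcd₀⟩

instance polishSpace_sequences {E : Type*} [TopologicalSpace E] [PolishSpace E] :
    PolishSpace (ℕ → E) := inferInstance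

instance polishSpace_prod {E F : Type*} [TopologicalSpace E] [PolishSpace E]
    [TopologicalSpace F] [PolishSpace F] : PolishSpace (E × F) := inferInstance

instance borelSpace_sequences {E : Type*} [TopologicalSpace E] [PolishSpace E]
    [MeasurableSpace E] [BorelSpace E] : BorelSpace (ℕ → E) := inferInstance

theorem exists_continuous_parametrization {B : Set (Cantor × Cantor)} (hB : MeasurableSet B) :
    ∃ h : (ℕ → ℕ) → Cantor × Cantor × Bool, Continuous h ∧
      (∀ v, (h v).2.2 = true ↔ ((h v).1, (h v).2.1) ∈ B) ∧
      ∀ α y, ∃ v, (h v).1 = α ∧ (h v).2.1 = y := by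
  let G : Set (Cantor × Cantor × Bool) := {c | c.2.2 = true ↔ (c.1, c.2.1) ∈ B}
  have hG : MeasurableSet G := by
    have h1 : Measurable fun c : Cantor × Cantor × Bool => c.2.2 = true :=
      measurableSet_setOfPred.1 (measurableSet_eq_fun (by fun_prop) measurable_const)
    have hm : Measurable fun c : Cantor × Cantor × Bool => (c.1, c.2.1) := by fun_prop
    exact measurableSet_setOfPred.2 (h1.iff (measurableSet_setOfPred.1 (hm hB)))
  have hmem : ∀ α y, ∃ b : Bool, (α, y, b) ∈ G := fun α y => by
    by_cases hy : (α, y) ∈ B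
    · exact ⟨true, by simpa [G] using hy⟩
    · exact ⟨false, by simpa [G] using hy⟩
  have hA := hG.analyticSet
  rw [AnalyticSet] at hA
  rcases hA with h0 | ⟨h, hc, hr⟩
  · obtain ⟨b, hb⟩ := hmem 0 0
    rw [h0] at hb
    exact hb.elim
  · refine ⟨h, hc, fun v => hr.subset ⟨v, rfl⟩, fun α y => ?_⟩
    obtain ⟨b, hb⟩ := hmem α y
    obtain ⟨v, hv⟩ := hr.symm.subset hb
    exact ⟨v, by rw [hv], by rw [hv]⟩

theorem exists_enumeration_Icc {ξ : Ordinal.{0}} (h1 : 1 ≤ ξ)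
    (hcount : ξ.card ≤ Cardinal.aleph0) :
    ∃ o : ℕ → Ordinal.{0}, (∀ i, 1 ≤ o i) ∧ ∀ ζ, 1 ≤ ζ → ζ ≤ ξ → ∃ i, o i = ζ := by
  have hc : (Set.Icc 1 ξ).Countable := by
    refine ((countable_Iio_of_card_le hcount).insert ξ).mono fun ζ hζ => ?_
    rcases hζ.2.eq_or_lt with h | h
    · exact Or.inl h
    · exact Or.inr h
  obtain ⟨o, ho⟩ := hc.exists_eq_range ⟨1, le_rfl, h1⟩
  refine ⟨o, fun i => (ho.symm.subset ⟨i, rfl⟩).1, fun ζ hζ hζ' => ?_⟩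
  exact ho.subset ⟨hζ, hζ'⟩

/-- The space of potential certificates. -/
abbrev CertificateSpace : Type :=
  (ℕ → ℕ → ℕ) × (ℕ → ℕ) × (ℕ → ℕ → Bool) × (ℕ → ℕ → ℕ → Bool)

theorem isCertificate_iff {h : (ℕ → ℕ) → Cantor × Cantor × Bool} {o : ℕ → Ordinal.{0}}
    {ξ : Ordinal.{0}} {α : Cantor} {w : ℕ → ℕ → ℕ} {k : ℕ → ℕ} {le : ℕ → ℕ → Prop}
    {tri : ℕ → ℕ → ℕ → Prop} : IsCertificate h o ξ α w k le tri ↔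
    (∀ p, (h (w p)).1 = α) ∧ (∀ p, le p p) ∧ (∀ p q r, le p q → le q r → le p r) ∧
    (∀ p q, le p q → k q ≤ k p) ∧ (∀ p q, le p q → ∀ i, i < k q → w p i = w q i) ∧
    (∀ p q, le p q → ∀ i, i < k q → (h (w p)).2.1 i = (h (w q)).2.1 i) ∧
    (∀ p q, le p q → (h (w p)).2.2 = (h (w q)).2.2) ∧ (∀ p, ∃ q, le q p ∧ k p < k q) ∧
    (∀ i p p' q, le p' p → tri i p q → tri i p' q) ∧
    (∀ i j p q, tri i p q → o j < o i → ∃ q', le q' q ∧ tri j q' p) ∧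
    (∀ i p q, o i = 1 → tri i p q → ∃ q', le q' q ∧ k p ≤ k q' ∧
      ∀ j, j < k p → (h (w q')).2.1 j = (h (w p)).2.1 j) ∧
    ∃ p q, (h (w p)).2.2 = true ∧ (h (w q)).2.2 = false ∧ ∀ i, o i = ξ → tri i p q :=
  ⟨fun ⟨h1, h2, h3, h4, h5, h6, h7, h8, h9, h10, h11, h12⟩ =>
    ⟨h1, h2, h3, h4, h5, h6, h7, h8, h9, h10, h11, h12⟩,
  fun ⟨h1, h2, h3, h4, h5, h6, h7, h8, h9, h10, h11, h12⟩ =>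
    ⟨h1, h2, h3, h4, h5, h6, h7, h8, h9, h10, h11, h12⟩⟩

theorem measurableSet_isCertificate {h : (ℕ → ℕ) → Cantor × Cantor × Bool} (hc : Continuous h)
    (o : ℕ → Ordinal.{0}) (ξ : Ordinal.{0}) :
    MeasurableSet {z : Cantor × CertificateSpace | IsCertificate h o ξ z.1 z.2.1 z.2.2.1
      (fun p q => z.2.2.2.1 p q = true) (fun i p q => z.2.2.2.2 i p q = true)} := by
  have hh := hc.measurable
  have hw : ∀ p, Measurable fun z : Cantor × CertificateSpace => z.2.1 p := by fun_prop
  have hα : ∀ p, Measurable fun z : Cantor × CertificateSpace => (h (z.2.1 p)).1 = z.1 :=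
    fun p => measurableSet_setOfPred.1 (measurableSet_eq_fun (by fun_prop) (by fun_prop))
  have hwe : ∀ p q i, Measurable fun z : Cantor × CertificateSpace => z.2.1 p i = z.2.1 q i :=
    fun p q i => measurableSet_setOfPred.1 (measurableSet_eq_fun (by fun_prop) (by fun_prop))
  have hy : ∀ p i, Measurable fun z : Cantor × CertificateSpace => (h (z.2.1 p)).2.1 i := by
    fun_prop
  have hye : ∀ p q i, Measurable fun z : Cantor × CertificateSpace =>
      (h (z.2.1 p)).2.1 i = (h (z.2.1 q)).2.1 i :=
    fun p q i => measurableSet_setOfPred.1 (measurableSet_eq_fun (hy p i) (hy q i))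
  have hbe : ∀ p q, Measurable fun z : Cantor × CertificateSpace =>
      (h (z.2.1 p)).2.2 = (h (z.2.1 q)).2.2 :=
    fun p q => measurableSet_setOfPred.1 (measurableSet_eq_fun (by fun_prop) (by fun_prop))
  have hb : ∀ p b, Measurable fun z : Cantor × CertificateSpace => (h (z.2.1 p)).2.2 = b :=
    fun p b => measurableSet_setOfPred.1 (measurableSet_eq_fun (by fun_prop) measurable_const)
  have hk : ∀ p i, Measurable fun z : Cantor × CertificateSpace => i < z.2.2.1 p :=
    fun p i => measurableSet_setOfPred.1 (measurableSet_lt measurable_const (by fun_prop))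
  have hkl : ∀ p q, Measurable fun z : Cantor × CertificateSpace => z.2.2.1 p < z.2.2.1 q :=
    fun p q => measurableSet_setOfPred.1 (measurableSet_lt (by fun_prop) (by fun_prop))
  have hkle : ∀ p q, Measurable fun z : Cantor × CertificateSpace => z.2.2.1 p ≤ z.2.2.1 q :=
    fun p q => measurableSet_setOfPred.1 (measurableSet_le (by fun_prop) (by fun_prop))
  have hl : ∀ p q, Measurable fun z : Cantor × CertificateSpace => z.2.2.2.1 p q = true :=
    fun p q => measurableSet_setOfPred.1 (measurableSet_eq_fun (by fun_prop) measurable_const)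
  have ht : ∀ i p q, Measurable fun z : Cantor × CertificateSpace => z.2.2.2.2 i p q = true :=
    fun i p q => measurableSet_setOfPred.1 (measurableSet_eq_fun (by fun_prop) measurable_const)
  have hP : ∀ P : Prop, Measurable fun _ : Cantor × CertificateSpace => P :=
    fun P => measurable_const
  rw [measurableSet_setOfPred]
  simp only [isCertificate_iff]
  refine .and (.forall fun p => hα p) <| .and (.forall fun p => hl p p) <|
    .and (.forall fun p => .forall fun q => .forall fun r =>
      (hl p q).imp ((hl q r).imp (hl p r))) <|
    .and (.forall fun p => .forall fun q => (hl p q).imp (hkle q p)) <|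
    .and (.forall fun p => .forall fun q => (hl p q).imp (.forall fun i =>
      (hk q i).imp (hwe p q i))) <|
    .and (.forall fun p => .forall fun q => (hl p q).imp (.forall fun i =>
      (hk q i).imp (hye p q i))) <|
    .and (.forall fun p => .forall fun q => (hl p q).imp (hbe p q)) <|
    .and (.forall fun p => .exists fun q => (hl q p).and (hkl p q)) <|
    .and (.forall fun i => .forall fun p => .forall fun p' => .forall fun q =>
      (hl p' p).imp ((ht i p q).imp (ht i p' q))) <|
    .and (.forall fun i => .forall fun j => .forall fun p => .forall fun q =>
      (ht i p q).imp ((hP _).imp (.exists fun q' => (hl q' q).and (ht j q' p)))) <|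
    .and (.forall fun i => .forall fun p => .forall fun q =>
      (hP _).imp ((ht i p q).imp (.exists fun q' => (hl q' q).and ((hkle p q').and
        (.forall fun j => (hk p j).imp (hye q' p j)))))) <|
    .exists fun p => .exists fun q => (hb p true).and ((hb q false).and
      (.forall fun i => (hP _).imp (ht i p q)))

theorem analyticSet_section_not_mem_sigmaZero {B : Set (Cantor × Cantor)} (hB : MeasurableSet B)
    {ξ : Ordinal.{0}} (h1 : 1 ≤ ξ) (hcount : ξ.card ≤ Cardinal.aleph0) :
    AnalyticSet {α : Cantor | {β | (α, β) ∈ B} ∉ SigmaZero Cantor ξ} := by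
  classical
  have : PolishSpace CertificateSpace := inferInstance
  have : PolishSpace Cantor := inferInstance
  have : PolishSpace (Cantor × CertificateSpace) := inferInstance
  have : BorelSpace (ℕ → ℕ → ℕ) := inferInstance
  have : BorelSpace (ℕ → ℕ → Bool) := inferInstance
  have : BorelSpace (ℕ → ℕ → ℕ → Bool) := inferInstance
  have : BorelSpace ((ℕ → ℕ → Bool) × (ℕ → ℕ → ℕ → Bool)) := Prod.borelSpace
  have : BorelSpace ((ℕ → ℕ) × (ℕ → ℕ → Bool) × (ℕ → ℕ → ℕ → Bool)) := Prod.borelSpace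
  have : BorelSpace CertificateSpace := Prod.borelSpace
  have : BorelSpace (Cantor × CertificateSpace) := Prod.borelSpace
  obtain ⟨h, hc, hhB, hsurj⟩ := exists_continuous_parametrization hB
  obtain ⟨o, ho1, ho⟩ := exists_enumeration_Icc h1 hcount
  convert (measurableSet_isCertificate hc o ξ).analyticSet.image_of_continuous continuous_fst
    using 1
  ext α
  constructor
  · intro hα
    obtain ⟨w, k, le, tri, H⟩ := exists_isCertificate hhB (hsurj α) hα o ho1
    refine ⟨(α, w, k, fun p q => decide (le p q), fun i p q => decide (tri i p q)), ?_, rfl⟩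
    simpa using H
  · rintro ⟨z, hz, rfl⟩
    exact IsCertificate.not_mem_sigmaZero hc hz ho h1 hhB

theorem exists_isClosed_projection_section_not_mem_sigmaZero {B : Set (Cantor × Cantor)}
    (hB : MeasurableSet B) {ξ : Ordinal.{0}} (h1 : 1 ≤ ξ) (hcount : ξ.card ≤ Cardinal.aleph0) :
    ∃ K : Set (Cantor × (ℕ → ℕ)), IsClosed K ∧
      ∀ α, {β | (α, β) ∈ B} ∉ SigmaZero Cantor ξ ↔ ∃ z, (α, z) ∈ K := by
  have hA := analyticSet_section_not_mem_sigmaZero hB h1 hcount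
  rw [AnalyticSet] at hA
  rcases hA with h0 | ⟨f, hf, hr⟩
  · refine ⟨∅, isClosed_empty, fun α => ?_⟩
    have : α ∉ {α : Cantor | {β | (α, β) ∈ B} ∉ SigmaZero Cantor ξ} := h0 ▸ Set.notMem_empty α
    simpa using this
  · refine ⟨{p | f p.2 = p.1}, isClosed_eq (hf.comp continuous_snd) continuous_fst, fun α => ?_⟩
    exact (Set.ext_iff.1 hr α).symm

theorem isClosed_setOf_mem_fiber {X : Type*} [TopologicalSpace X] {g : X → ℕ} (hg : Continuous g)
    {F : ℕ → Set X} (hF : ∀ n, IsClosed (F n)) : IsClosed {x | x ∈ F (g x)} := by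
  have : {x | x ∈ F (g x)}ᶜ = ⋃ n, g ⁻¹' {n} ∩ (F n)ᶜ := by
    ext x; simp
  rw [← isOpen_compl_iff, this]
  exact isOpen_iUnion fun n => ((isOpen_discrete _).preimage hg).inter (hF n).isOpen_compl

/-- `S` is the projection of a closed set all of whose partial projections lie in `Γ`. -/
def HasGoodCode (Γ : Set (Set Cantor)) (S : Set Cantor) : Prop :=
  ∃ F : Set (Cantor × (ℕ → ℕ)), IsClosed F ∧ (∀ y, y ∈ S ↔ ∃ β, (y, β) ∈ F) ∧
    ∀ (a : Set ℕ) (β₀ : ℕ → ℕ), {y | ∃ β, (∀ i ∈ a, β i = β₀ i) ∧ (y, β) ∈ F} ∈ Γ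

theorem HasGoodCode.of_isOpen {Γ : Set (Set Cantor)} (hΓ : ∀ U, IsOpen U → U ∈ Γ) {S : Set Cantor}
    (hS : IsOpen S) : HasGoodCode Γ S := by
  classical
  obtain ⟨C, hC, hSC⟩ : ∃ C : ℕ → Set Cantor, (∀ n, IsClopen (C n)) ∧ S = ⋃ n, C n := by
    let C : List (Fin 2) → Set Cantor := fun s =>
      {y | (∀ i (hi : i < s.length), y i = s[i]) ∧ ∀ z : Cantor, (∀ i < s.length, z i = y i) → z ∈ S}
    have hC : ∀ s, IsClopen (C s) := fun s => by
      by_cases hs : (C s).Nonempty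
      · obtain ⟨y, hy⟩ := hs
        convert isClopen_agree y s.length using 1
        ext z
        constructor
        · exact fun hz i hi => (hz.1 i hi).trans (hy.1 i hi).symm
        · exact fun hz => ⟨fun i hi => (hz i hi).trans (hy.1 i hi),
            fun z' hz' => hy.2 z' fun i hi => (hz' i hi).trans (hz i hi)⟩
      · rw [Set.not_nonempty_iff_eq_empty.1 hs]; exact isClopen_empty
    obtain ⟨e, he⟩ := exists_surjective_nat (List (Fin 2))
    refine ⟨fun n => C (e n), fun n => hC _, ?_⟩
    ext y
    constructor
    · intro hy
      obtain ⟨n, hn⟩ := hS.exists_agree_subset hy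
      obtain ⟨m, hm⟩ := he (List.ofFn fun i : Fin n => y i)
      refine Set.mem_iUnion.2 ⟨m, ?_⟩
      rw [hm]
      exact ⟨fun i hi => by simp, fun z hz => hn z (by simpa using hz)⟩
    · intro hy
      obtain ⟨n, hn⟩ := Set.mem_iUnion.1 hy
      exact hn.2 y fun _ _ => rfl
  refine ⟨{p | p ∈ Prod.fst ⁻¹' C (p.2 0)}, isClosed_setOf_mem_fiber
    ((continuous_apply 0).comp continuous_snd) fun n => (hC n).isClosed.preimage continuous_fst,
    fun y => ?_, fun a β₀ => ?_⟩
  · rw [hSC, Set.mem_iUnion]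
    exact ⟨fun ⟨n, hn⟩ => ⟨fun _ => n, hn⟩, fun ⟨β, hβ⟩ => ⟨β 0, hβ⟩⟩
  · apply hΓ
    have : {y | ∃ β : ℕ → ℕ, (∀ i ∈ a, β i = β₀ i) ∧ (y, β) ∈ {p : Cantor × (ℕ → ℕ) |
        p ∈ Prod.fst ⁻¹' C (p.2 0)}} =
        ⋃ β : {β : ℕ → ℕ // ∀ i ∈ a, β i = β₀ i}, C (β.1 0) := by
      ext y; simp
    rw [this]
    exact isOpen_iUnion fun β => (hC _).isOpen

theorem HasGoodCode.iUnion {Γ : Set (Set Cantor)} (hΓ : ∀ f : ℕ → Set Cantor, (∀ n, f n ∈ Γ) →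
    ⋃ n, f n ∈ Γ) (h0 : ∅ ∈ Γ) {S : ℕ → Set Cantor} (hS : ∀ n, HasGoodCode Γ (S n)) :
    HasGoodCode Γ (⋃ n, S n) := by
  classical
  choose F hF hFS hFa using hS
  let cns : ℕ → (ℕ → ℕ) → ℕ → ℕ := fun n β i => Nat.casesOn (motive := fun _ => ℕ) i n β
  refine ⟨{p | p ∈ (fun p : Cantor × (ℕ → ℕ) => (p.1, fun i => p.2 (i + 1))) ⁻¹' F (p.2 0)},
    isClosed_setOf_mem_fiber ((continuous_apply 0).comp continuous_snd)
      fun n => (hF n).preimage (continuous_fst.prodMk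
        (continuous_pi fun i => (continuous_apply (i + 1)).comp continuous_snd)),
    fun y => ?_, fun a β₀ => ?_⟩
  · simp only [Set.mem_iUnion, hFS]
    exact ⟨fun ⟨n, β, hβ⟩ => ⟨cns n β, show (y, β) ∈ F n from hβ⟩,
      fun ⟨β, hβ⟩ => ⟨β 0, fun i => β (i + 1), hβ⟩⟩
  · convert hΓ (fun n => if 0 ∈ a → n = β₀ 0 then {y | ∃ β, (∀ i ∈ {i | i + 1 ∈ a},
      β i = (fun i => β₀ (i + 1)) i) ∧ (y, β) ∈ F n} else ∅) ?_ using 1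
    · ext y
      simp only [Set.mem_iUnion]
      constructor
      · rintro ⟨β, h1, h2⟩
        refine ⟨β 0, ?_⟩
        rw [if_pos fun h => h1 0 h]
        exact ⟨fun i => β (i + 1), fun i hi => h1 _ hi, h2⟩
      · rintro ⟨n, hn⟩
        split_ifs at hn with h
        · obtain ⟨β, h1, h2⟩ := hn
          refine ⟨cns n β, fun i hi => ?_, show (y, β) ∈ F n from h2⟩
          cases i with
          | zero => exact h hi
          | succ i => exact h1 i hi
        · exact hn.elim
    · intro n
      dsimp only
      split_ifs
      · exact hFa n _ _
      · exact h0

theorem HasGoodCode.iInter {Γ : Set (Set Cantor)} (hΓ : ∀ f : ℕ → Set Cantor, (∀ n, f n ∈ Γ) →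
    ⋂ n, f n ∈ Γ) {S : ℕ → Set Cantor} (hS : ∀ n, HasGoodCode Γ (S n)) :
    HasGoodCode Γ (⋂ n, S n) := by
  choose F hF hFS hFa using hS
  have hglue : ∀ (γ : ℕ → ℕ → ℕ) n, (fun i => (fun j => γ j.unpair.1 j.unpair.2) (Nat.pair n i)) =
    γ n := fun γ n => by ext i; simp
  refine ⟨⋂ n, (fun p : Cantor × (ℕ → ℕ) => (p.1, fun i => p.2 (Nat.pair n i))) ⁻¹' F n,
    isClosed_iInter fun n => (hF n).preimage (continuous_fst.prodMk
        (continuous_pi fun i => (continuous_apply _).comp continuous_snd)),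
    fun y => ?_, fun a β₀ => ?_⟩
  · simp only [Set.mem_iInter, hFS, Set.mem_preimage]
    constructor
    · intro h
      choose γ hγ using h
      exact ⟨fun j => γ j.unpair.1 j.unpair.2, fun n => by rw [hglue]; exact hγ n⟩
    · exact fun ⟨β, hβ⟩ n => ⟨_, hβ n⟩
  · convert hΓ (fun n => {y | ∃ β, (∀ i ∈ {i | Nat.pair n i ∈ a},
      β i = (fun i => β₀ (Nat.pair n i)) i) ∧ (y, β) ∈ F n}) (fun n => hFa n _ _) using 1
    ext y
    simp only [Set.mem_iInter, Set.mem_preimage]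
    constructor
    · rintro ⟨β, h1, h2⟩ n
      exact ⟨_, fun i hi => h1 _ hi, h2 n⟩
    · intro h
      choose γ h1 h2 using h
      refine ⟨fun j => γ j.unpair.1 j.unpair.2, fun j hj => ?_, fun n => by rw [hglue]; exact h2 n⟩
      have := h1 j.unpair.1 j.unpair.2 (by simpa using hj)
      simpa using this

theorem HasGoodCode.mono {Γ Γ' : Set (Set Cantor)} (h : Γ ⊆ Γ') {S : Set Cantor}
    (hS : HasGoodCode Γ S) : HasGoodCode Γ' S := by
  obtain ⟨F, h1, h2, h3⟩ := hS
  exact ⟨F, h1, h2, fun a β₀ => h (h3 a β₀)⟩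

theorem hasGoodCode (ξ : Ordinal.{0}) :
    (∀ S ∈ SigmaZero Cantor ξ, HasGoodCode (SigmaZero Cantor ξ) S) ∧
    ∀ S ∈ PiZero Cantor ξ, HasGoodCode (PiZero Cantor ξ) S := by
  induction ξ using WellFoundedLT.induction with
  | ind ξ ih =>
  rcases le_or_gt ξ 1 with h | h
  · refine ⟨fun S hS => .of_isOpen (fun U => isOpen_mem_sigmaZero)
      ((mem_sigmaZero_of_le_one h).1 hS), fun S hS => ?_⟩
    have hcl : IsClosed S := isOpen_compl_iff.1 ((mem_sigmaZero_of_le_one h).1 hS)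
    refine ⟨Prod.fst ⁻¹' S, hcl.preimage continuous_fst, fun y => by simp, fun a β₀ => ?_⟩
    convert hS using 1
    ext y
    exact ⟨fun ⟨β, _, hβ⟩ => hβ, fun hy => ⟨β₀, fun _ _ => rfl, hy⟩⟩
  · constructor
    · intro S hS
      obtain ⟨f, hf, rfl⟩ := (mem_sigmaZero_of_one_lt h).1 hS
      refine .iUnion (fun _ => sigmaZero_iUnion) (isOpen_mem_sigmaZero isOpen_empty) fun n => ?_
      obtain ⟨η, h1, h2, h3⟩ := hf n
      exact ((ih η h2).2 _ h3).mono fun s hs => sigmaZero_of_compl h1 h2 hs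
    · intro S hS
      obtain ⟨f, hf, hSf⟩ := (mem_sigmaZero_of_one_lt h).1 hS
      have hSf' : S = ⋂ n, (f n)ᶜ := by rw [← Set.compl_iUnion, ← hSf, compl_compl]
      rw [hSf']
      refine .iInter (fun _ => piZero_iInter) fun n => ?_
      obtain ⟨η, h1, h2, h3⟩ := hf n
      exact ((ih η h2).1 _ h3).mono fun s hs =>
        sigmaZero_of_compl (s := sᶜ) h1 h2 (by rwa [compl_compl])

theorem exists_closed_family {B : Set (Cantor × Cantor)} (hB : MeasurableSet B)
    {ξ : Ordinal.{0}} (h1 : 1 ≤ ξ) (hcount : ξ.card ≤ Cardinal.aleph0) :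
    ∃ 𝔽 : Set (Cantor × Cantor × (ℕ → ℕ)), IsClosed 𝔽 ∧ ∀ α,
      ({β | (α, β) ∈ B} ∈ SigmaZero Cantor ξ → ∀ (a : Set ℕ) (β₀ : ℕ → ℕ),
        {y | ∃ β, (∀ i ∈ a, β i = β₀ i) ∧ (α, y, β) ∈ 𝔽} ∈ SigmaZero Cantor ξ) ∧
      ({β | (α, β) ∈ B} ∈ PiZero Cantor ξ → ∀ (a : Set ℕ) (β₀ : ℕ → ℕ),
        {y | ∃ β, (∀ i ∈ a, β i = β₀ i) ∧ (α, y, β) ∈ 𝔽} ∈ PiZero Cantor ξ) ∧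
      ({y | ∃ β, (α, y, β) ∈ 𝔽} ∈ SigmaZero Cantor ξ →
        {β | (α, β) ∈ B} ∈ SigmaZero Cantor ξ) ∧
      ({y | ∃ β, (α, y, β) ∈ 𝔽} ∈ PiZero Cantor ξ → {β | (α, β) ∈ B} ∈ PiZero Cantor ξ) := by
  obtain ⟨D, hD, hD'⟩ := exists_piZero_not_sigmaZero hcount
  have hDc : Dᶜ ∈ SigmaZero Cantor ξ := hD
  obtain ⟨F, hF, hFD, hFa⟩ := (hasGoodCode ξ).2 D hD
  obtain ⟨F', hF', hFD', hFa'⟩ := (hasGoodCode ξ).1 Dᶜ hDc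
  obtain ⟨K, hK, hKB⟩ := exists_isClosed_projection_section_not_mem_sigmaZero hB h1 hcount
  obtain ⟨K', hK', hKB'⟩ :=
    exists_isClosed_projection_section_not_mem_sigmaZero hB.compl h1 hcount
  have hKB'' : ∀ α, {β | (α, β) ∈ B} ∉ PiZero Cantor ξ ↔ ∃ z, (α, z) ∈ K' := hKB'
  let t : Cantor → Cantor := fun y i => y (i + 1)
  have ht : Continuous t := continuous_pi fun i => continuous_apply _
  let ev : (ℕ → ℕ) → ℕ → ℕ := fun β i => β (2 * i)
  have hev : Continuous ev := continuous_pi fun i => continuous_apply _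
  let od : (ℕ → ℕ) → ℕ → ℕ := fun β i => β (2 * i + 1)
  have hod : Continuous od := continuous_pi fun i => continuous_apply _
  let mix : (ℕ → ℕ) → (ℕ → ℕ) → ℕ → ℕ := fun γ δ i => if i % 2 = 0 then γ (i / 2) else δ (i / 2)
  have hmix : ∀ γ δ, ev (mix γ δ) = γ ∧ od (mix γ δ) = δ := fun γ δ => by
    constructor
    · ext i; simp [ev, mix]
    · ext i
      have e1 : (2 * i + 1) % 2 = 1 := by omega
      have e2 : (2 * i + 1) / 2 = i := by omega
      simp [od, mix, e1, e2]
  let hd : Fin 2 → Set Cantor := fun b => {y | y 0 = b}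
  have hhd : ∀ b, IsClopen (hd b) := fun b =>
    (isClopen_discrete {b}).preimage (continuous_apply (A := fun _ : ℕ => Fin 2) 0)
  let G : Fin 2 → Set (Cantor × (ℕ → ℕ)) → Set (Cantor × (ℕ → ℕ)) →
    Set (Cantor × Cantor × (ℕ → ℕ)) := fun b K F =>
      {p | p.2.1 ∈ hd b ∧ (p.1, ev p.2.2) ∈ K ∧ (t p.2.1, od p.2.2) ∈ F}
  have hG : ∀ b K F, IsClosed K → IsClosed F → IsClosed (G b K F) := fun b K F hK hF =>
    ((hhd b).isClosed.preimage (by fun_prop)).inter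
      ((hK.preimage (by fun_prop)).inter (hF.preimage (by fun_prop)))
  have hGa : ∀ b K F α (a : Set ℕ) (β₀ : ℕ → ℕ),
      {y | ∃ β, (∀ i ∈ a, β i = β₀ i) ∧ (α, y, β) ∈ G b K F} =
      {y | y ∈ hd b ∧ (∃ γ, (∀ i, 2 * i ∈ a → γ i = ev β₀ i) ∧ (α, γ) ∈ K) ∧
        t y ∈ {y | ∃ δ, (∀ i ∈ {i | 2 * i + 1 ∈ a}, δ i = od β₀ i) ∧ (y, δ) ∈ F}} := by
    intro b K F α a β₀
    ext y
    constructor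
    · rintro ⟨β, hβ, h2, h3, h4⟩
      exact ⟨h2, ⟨_, fun i hi => hβ _ hi, h3⟩, ⟨_, fun i hi => hβ _ hi, h4⟩⟩
    · rintro ⟨h2, ⟨γ, hγ, h3⟩, ⟨δ, hδ, h4⟩⟩
      refine ⟨mix γ δ, fun i hi => ?_, h2, by rwa [(hmix γ δ).1], by rwa [(hmix γ δ).2]⟩
      rcases Nat.even_or_odd' i with ⟨j, rfl | rfl⟩
      · have := congrFun (hmix γ δ).1 j
        exact this.trans (hγ j hi)
      · have := congrFun (hmix γ δ).2 j
        exact this.trans (hδ j hi)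
  have hsplit : ∀ α (a : Set ℕ) (β₀ : ℕ → ℕ),
      {y | ∃ β, (∀ i ∈ a, β i = β₀ i) ∧ (α, y, β) ∈ G 0 K F ∪ G 1 K' F'} =
      {y | ∃ β, (∀ i ∈ a, β i = β₀ i) ∧ (α, y, β) ∈ G 0 K F} ∪
      {y | ∃ β, (∀ i ∈ a, β i = β₀ i) ∧ (α, y, β) ∈ G 1 K' F'} := by
    intro α a β₀
    ext y
    simp only [Set.mem_union, Set.mem_ofPred_eq, and_or_left, exists_or]
  have hempty : ∀ b K F α (a : Set ℕ) (β₀ : ℕ → ℕ), (¬ ∃ z, (α, z) ∈ K) →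
      {y | ∃ β, (∀ i ∈ a, β i = β₀ i) ∧ (α, y, β) ∈ G b K F} = ∅ := by
    intro b K F α a β₀ hK
    rw [Set.eq_empty_iff_forall_notMem]
    rintro y ⟨β, -, -, h3, -⟩
    exact hK ⟨_, h3⟩
  have hGS : ∀ b K F α (a : Set ℕ) (β₀ : ℕ → ℕ), {y | ∃ β, (∀ i ∈ a, β i = β₀ i) ∧
      (α, y, β) ∈ G b K F} = ∅ ∨ {y | ∃ β, (∀ i ∈ a, β i = β₀ i) ∧ (α, y, β) ∈ G b K F} =
      hd b ∩ t ⁻¹' {y | ∃ δ, (∀ i ∈ {i | 2 * i + 1 ∈ a}, δ i = od β₀ i) ∧ (y, δ) ∈ F} := by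
    intro b K F α a β₀
    rw [hGa]
    by_cases hex : ∃ γ, (∀ i, 2 * i ∈ a → γ i = ev β₀ i) ∧ (α, γ) ∈ K
    · right
      ext y
      exact ⟨fun hy => ⟨hy.1, hy.2.2⟩, fun hy => ⟨hy.1, hex, hy.2⟩⟩
    · left
      rw [Set.eq_empty_iff_forall_notMem]
      exact fun y hy => hex hy.2.1
  let cons : Fin 2 → Cantor → Cantor := fun b y i => Nat.casesOn i b y
  have hcons : ∀ b, Continuous (cons b) := fun b => continuous_pi fun i => by
    cases i with
    | zero => exact continuous_const
    | succ i => exact continuous_apply i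
  refine ⟨G 0 K F ∪ G 1 K' F', (hG _ _ _ hK hF).union (hG _ _ _ hK' hF'), fun α =>
    ⟨fun hα a β₀ => ?_, fun hα a β₀ => ?_, fun hE => ?_, fun hE => ?_⟩⟩
  · rw [hsplit, hempty 0 K F α a β₀ (fun hz => (hKB α).2 hz hα), Set.empty_union]
    rcases hGS 1 K' F' α a β₀ with h | h <;> rw [h]
    · exact isOpen_mem_sigmaZero isOpen_empty
    · exact sigmaZero_inter (isOpen_mem_sigmaZero (hhd 1).isOpen)
        (sigmaZero_preimage ht (hFa' _ _))
  · rw [hsplit, hempty 1 K' F' α a β₀ (fun hz => (hKB'' α).2 hz hα), Set.union_empty]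
    rcases hGS 0 K F α a β₀ with h | h <;> rw [h]
    · exact isOpen_mem_sigmaZero (s := ∅ᶜ) (by simp)
    · have h2 := piZero_preimage ht (hFa {i | 2 * i + 1 ∈ a} (od β₀))
      have h3 : (t ⁻¹' {y | ∃ δ, (∀ i ∈ {i | 2 * i + 1 ∈ a}, δ i = od β₀ i) ∧ (y, δ) ∈ F})ᶜ ∈
        SigmaZero Cantor ξ := h2
      rw [PiZero, Set.mem_ofPred_eq, Set.compl_inter]
      exact sigmaZero_union (isOpen_mem_sigmaZero (hhd 0).isClosed.isOpen_compl) h3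
  · by_contra hα
    obtain ⟨z, hz⟩ := (hKB α).1 hα
    refine hD' ?_
    convert sigmaZero_preimage (hcons 0) hE using 1
    ext y
    rw [hFD]
    constructor
    · rintro ⟨δ, hδ⟩
      exact ⟨mix z δ, Or.inl ⟨rfl, by rwa [(hmix z δ).1], by rwa [(hmix z δ).2]⟩⟩
    · rintro ⟨β, ⟨-, -, h⟩ | ⟨h, -⟩⟩
      · exact ⟨_, h⟩
      · exact (zero_ne_one (α := Fin 2) h).elim
  · by_contra hα
    obtain ⟨z, hz⟩ := (hKB'' α).1 hα
    refine hD' ?_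
    have h2 : (cons 1 ⁻¹' {y | ∃ β, (α, y, β) ∈ G 0 K F ∪ G 1 K' F'})ᶜ ∈ SigmaZero Cantor ξ :=
      piZero_preimage (hcons 1) hE
    convert h2 using 1
    rw [← compl_inj_iff, compl_compl]
    ext y
    rw [hFD']
    constructor
    · rintro ⟨δ, hδ⟩
      exact ⟨mix z δ, Or.inr ⟨rfl, by rwa [(hmix z δ).1], by rwa [(hmix z δ).2]⟩⟩
    · rintro ⟨β, ⟨h, -⟩ | ⟨-, -, h⟩⟩
      · exact (zero_ne_one (α := Fin 2) h.symm).elim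
      · exact ⟨_, h⟩

/-- The prefix of length `n` of an infinite sequence. -/
def pre {A : Type*} (f : ℕ → A) (n : ℕ) : List A := (List.range n).map f

/-- The word read in `x` between positions `a` and `b`. -/
def slice {A : Type*} (x : ℕ → A) (a b : ℕ) : List A := pre (fun j => x (a + j)) (b - a)

section Words
variable {A : Type*}

@[simp] theorem length_pre (f : ℕ → A) (n : ℕ) : (pre f n).length = n := by simp [pre]

theorem pre_eq_pre_iff {f g : ℕ → A} {m n : ℕ} :
    pre f m = pre g n ↔ m = n ∧ ∀ j < m, f j = g j := by
  constructor
  · intro h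
    have hl := congrArg List.length h
    simp only [length_pre] at hl
    subst hl
    exact ⟨rfl, by simpa [pre] using h⟩
  · rintro ⟨rfl, h⟩
    simpa [pre] using h

@[simp] theorem length_slice (x : ℕ → A) (a b : ℕ) : (slice x a b).length = b - a := by
  simp [slice]

theorem slice_append (x : ℕ → A) {a b c : ℕ} (h1 : a ≤ b) (h2 : b ≤ c) :
    slice x a b ++ slice x b c = slice x a c := by
  obtain ⟨m, rfl⟩ := Nat.exists_eq_add_of_le h1
  obtain ⟨n, rfl⟩ := Nat.exists_eq_add_of_le h2
  have e1 : a + m - a = m := by omega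
  have e2 : a + m + n - (a + m) = n := by omega
  have e3 : a + m + n - a = m + n := by omega
  simp only [slice, pre, e1, e2, e3, List.range_add, List.map_append, List.map_map]
  congr 1
  refine List.map_congr_left fun j _ => ?_
  simp [add_assoc]

theorem slice_eq_slice {x y : ℕ → A} {a b a' b' : ℕ} (hl : b - a = b' - a')
    (h : ∀ j, j < b - a → x (a + j) = y (a' + j)) : slice x a b = slice y a' b' :=
  pre_eq_pre_iff.2 ⟨hl, h⟩

theorem concatPrefix_succ (a : ℕ → List A) (m : ℕ) :
    concatPrefix a (m + 1) = concatPrefix a m ++ a m := by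
  simp [concatPrefix, List.range_succ]

theorem mem_omegaPower_iff {D : Set (List A)} (hD : [] ∉ D) {x : ℕ → A} :
    x ∈ omegaPower D ↔ ∃ p : ℕ → ℕ, p 0 = 0 ∧ ∀ n, slice x (p n) (p (n + 1)) ∈ D := by
  constructor
  · rintro ⟨a, ha, -, hx⟩
    refine ⟨fun n => (concatPrefix a n).length, by simp [concatPrefix], fun n => ?_⟩
    have : slice x (concatPrefix a n).length (concatPrefix a (n + 1)).length = a n := by
      refine List.ext_getElem (by simp [concatPrefix_succ]) fun j h1 h2 => ?_
      have h3 : (concatPrefix a n).length + j < (concatPrefix a (n + 1)).length := by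
        simp [concatPrefix_succ, h2]
      have := hx (n + 1) _ h3
      simp only [slice, pre, List.getElem_map, List.getElem_range]
      rw [← this]
      simp [concatPrefix_succ]
    rw [this]
    exact ha n
  · rintro ⟨p, hp, h⟩
    have hlt : ∀ n, p n < p (n + 1) := fun n => by
      by_contra hn
      refine hD ?_
      have := h n
      have e : p (n + 1) - p n = 0 := by omega
      simpa [slice, pre, e] using this
    have hmono : StrictMono p := strictMono_nat_of_lt_succ hlt
    have key : ∀ m, concatPrefix (fun n => slice x (p n) (p (n + 1))) m = slice x 0 (p m) := by
      intro m
      induction m with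
      | zero => simp [concatPrefix, slice, pre, hp]
      | succ m ih => rw [concatPrefix_succ, ih, slice_append x (Nat.zero_le _) (hlt m).le]
    refine ⟨_, h, fun n => ⟨n, ?_⟩, fun m k hk => ?_⟩
    · rw [key]
      simpa using hmono.le_apply
    · have : ∀ (l l' : List A) (e : l = l') (h : k < l.length), l.get ⟨k, h⟩ =
        l'.get ⟨k, e ▸ h⟩ := fun l l' e h => by subst e; rfl
      rw [this _ _ (key m)]
      simp [slice, pre]

end Words

/-! ### Block lengths -/

/-- Length of the block of zeros coding the word `s`. -/
def blockLen (s : List (Fin 2)) : ℕ := 2 * 4 ^ Nat.pair (Encodable.encode s) s.length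

/-- Place at which the block coding `s` may be cut, with memory `t`. -/
def cutLen (s : List (Fin 2)) (t : List ℕ) : ℕ :=
  4 ^ Nat.pair (Encodable.encode s) (Encodable.encode t)

theorem four_pow_add_two_mul_inj {a b c d : ℕ} (h : 4 ^ a + 2 * 4 ^ b = 4 ^ c + 2 * 4 ^ d) :
    a = c ∧ b = d := by
  induction a generalizing b c d with
  | zero =>
    have hc : c = 0 := by
      rcases c with _ | c
      · rfl
      · exfalso
        rw [pow_succ] at h
        omega
    subst hc
    refine ⟨rfl, Nat.pow_right_injective (le_refl 2 |>.trans (by norm_num : 2 ≤ 4)) ?_⟩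
    dsimp only
    omega
  | succ a ih =>
    have hc : c ≠ 0 := by
      rintro rfl
      rw [pow_succ] at h
      omega
    obtain ⟨c, rfl⟩ := Nat.exists_eq_succ_of_ne_zero hc
    rcases b with _ | b
    · rcases d with _ | d
      · have : 4 ^ a + 2 * 4 ^ 0 = 4 ^ c + 2 * 4 ^ 0 := by
          rw [Nat.succ_eq_add_one, pow_succ, pow_succ] at h
          omega
        exact ⟨by rw [(ih this).1], rfl⟩
      · rw [Nat.succ_eq_add_one, pow_succ, pow_succ, pow_succ] at h
        omega
    · rcases d with _ | d
      · rw [Nat.succ_eq_add_one, pow_succ, pow_succ, pow_succ] at h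
        omega
      · have : 4 ^ a + 2 * 4 ^ b = 4 ^ c + 2 * 4 ^ d := by
          rw [Nat.succ_eq_add_one, pow_succ, pow_succ, pow_succ, pow_succ] at h
          omega
        obtain ⟨h1, h2⟩ := ih this
        exact ⟨by rw [h1], by rw [h2]⟩

theorem cutLen_add_blockLen_inj {s s' u u' : List (Fin 2)} {t t' : List ℕ}
    (h : cutLen s t + blockLen u = cutLen s' t' + blockLen u') : s = s' ∧ t = t' := by
  have := (four_pow_add_two_mul_inj h).1
  rw [Nat.pair_eq_pair] at this
  exact ⟨Encodable.encode_injective this.1, Encodable.encode_injective this.2⟩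

theorem blockLen_injective : Function.Injective blockLen := by
  intro s s' h
  have h2 : cutLen [] [] + blockLen s = cutLen [] [] + blockLen s' := by rw [h]
  have := (four_pow_add_two_mul_inj h2).2
  rw [Nat.pair_eq_pair] at this
  exact Encodable.encode_injective this.1

theorem cutLen_lt_blockLen {s : List (Fin 2)} {t : List ℕ} (h : Encodable.encode t ≤ s.length) :
    cutLen s t < blockLen s := by
  have h1 : Nat.pair (Encodable.encode s) (Encodable.encode t) ≤
      Nat.pair (Encodable.encode s) s.length := by
    rcases h.eq_or_lt with h | h
    · rw [h]
    · exact (Nat.pair_lt_pair_right _ h).le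
  have h2 : 4 ^ Nat.pair (Encodable.encode s) (Encodable.encode t) ≤
      4 ^ Nat.pair (Encodable.encode s) s.length := Nat.pow_le_pow_right (by norm_num) h1
  have h3 : 0 < 4 ^ Nat.pair (Encodable.encode s) s.length := by positivity
  unfold cutLen blockLen
  omega

/-! ### The coding sequence -/

/-- The position at which the `i`-th block of the sequence coding `y` begins. -/
def blockStart (y : Cantor) : ℕ → ℕ
  | 0 => 0
  | i + 1 => blockStart y i + blockLen (pre y i) + 1

/-- The position of the `i`-th one in the sequence coding `y`. -/
def onePos (y : Cantor) (i : ℕ) : ℕ := blockStart y i + blockLen (pre y i)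

/-- The position inside block `i` of the sequence coding `y` where a cut with memory `t` is made. -/
def cutPos (y : Cantor) (i : ℕ) (t : List ℕ) : ℕ := blockStart y i + cutLen (pre y i) t

open Classical in
/-- The sequence coding `y`. -/
noncomputable def codeSeq (y : Cantor) : Cantor := fun n => if ∃ i, onePos y i = n then 1 else 0

theorem blockStart_succ (y : Cantor) (i : ℕ) : blockStart y (i + 1) = onePos y i + 1 := rfl

theorem blockStart_le_onePos (y : Cantor) (i : ℕ) : blockStart y i ≤ onePos y i :=
  Nat.le_add_right _ _

theorem onePos_strictMono (y : Cantor) : StrictMono (onePos y) :=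
  strictMono_nat_of_lt_succ fun i => by
    have := blockStart_le_onePos y (i + 1)
    rw [blockStart_succ] at this
    omega

theorem blockStart_congr {y y' : Cantor} {i : ℕ} (h : ∀ j < i, y j = y' j) :
    blockStart y i = blockStart y' i := by
  induction i with
  | zero => rfl
  | succ i ih =>
    have h' : ∀ j < i, y j = y' j := fun j hj => h j (by omega)
    rw [blockStart, blockStart, ih h', pre_eq_pre_iff.2 ⟨rfl, h'⟩]

theorem onePos_congr {y y' : Cantor} {i : ℕ} (h : ∀ j < i, y j = y' j) :
    onePos y i = onePos y' i := by
  rw [onePos, onePos, blockStart_congr h, pre_eq_pre_iff.2 ⟨rfl, h⟩]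

theorem cutPos_congr {y y' : Cantor} {i : ℕ} (h : ∀ j < i, y j = y' j) (t : List ℕ) :
    cutPos y i t = cutPos y' i t := by
  rw [cutPos, cutPos, blockStart_congr h, pre_eq_pre_iff.2 ⟨rfl, h⟩]

theorem codeSeq_eq_one_iff {y : Cantor} {n : ℕ} : codeSeq y n = 1 ↔ ∃ i, onePos y i = n := by
  unfold codeSeq
  split_ifs with h <;> simp [h]

theorem codeSeq_onePos (y : Cantor) (i : ℕ) : codeSeq y (onePos y i) = 1 :=
  codeSeq_eq_one_iff.2 ⟨i, rfl⟩

theorem eq_zero_of_ne_one {a : Fin 2} (h : a ≠ 1) : a = 0 := by omega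

theorem codeSeq_congr {y y' : Cantor} {i n : ℕ} (h : ∀ j < i, y j = y' j) (hn : n ≤ onePos y i) :
    codeSeq y n = codeSeq y' n := by
  have key : ∀ {y y' : Cantor}, (∀ j < i, y j = y' j) → n ≤ onePos y i → codeSeq y n = 1 →
      codeSeq y' n = 1 := by
    intro y y' h hn h1
    obtain ⟨j, rfl⟩ := codeSeq_eq_one_iff.1 h1
    have hj := (onePos_strictMono y).le_iff_le.1 hn
    exact codeSeq_eq_one_iff.2 ⟨j, (onePos_congr fun m hm => h m (by omega)).symm⟩
  by_cases h1 : codeSeq y n = 1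
  · rw [h1, key h hn h1]
  · by_cases h2 : codeSeq y' n = 1
    · exact absurd (key (fun j hj => (h j hj).symm) (by rwa [← onePos_congr h]) h2) h1
    · rw [eq_zero_of_ne_one h1, eq_zero_of_ne_one h2]

theorem codeSeq_eq_zero {y : Cantor} {i n : ℕ} (h1 : blockStart y i ≤ n) (h2 : n < onePos y i) :
    codeSeq y n = 0 := by
  refine eq_zero_of_ne_one fun h => ?_
  obtain ⟨j, rfl⟩ := codeSeq_eq_one_iff.1 h
  have hj := (onePos_strictMono y).lt_iff_lt.1 h2
  rcases i with _ | i
  · omega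
  · rw [blockStart_succ] at h1
    have := (onePos_strictMono y).monotone (show j ≤ i by omega)
    omega

theorem cutPos_lt_onePos (y : Cantor) {i : ℕ} {t : List ℕ} (h : Encodable.encode t ≤ i) :
    cutPos y i t < onePos y i := by
  have := cutLen_lt_blockLen (s := pre y i) (t := t) (by simpa using h)
  unfold cutPos onePos
  omega

theorem blockStart_le_cutPos (y : Cantor) (i : ℕ) (t : List ℕ) :
    blockStart y i ≤ cutPos y i t := Nat.le_add_right _ _

/-- The positions `a < b` carry consecutive ones of `x`. -/
def IsGap (x : Cantor) (a b : ℕ) : Prop :=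
  a < b ∧ x a = 1 ∧ x b = 1 ∧ ∀ c, a < c → c < b → x c = 0

theorem isGap_codeSeq (y : Cantor) (i : ℕ) : IsGap (codeSeq y) (onePos y i) (onePos y (i + 1)) :=
  ⟨onePos_strictMono y (Nat.lt_succ_self i), codeSeq_onePos y i, codeSeq_onePos y (i + 1),
    fun c h1 h2 => codeSeq_eq_zero (i := i + 1) (by rw [blockStart_succ]; omega) h2⟩

theorem IsGap.codeSeq_eq {y : Cantor} {a b : ℕ} (h : IsGap (codeSeq y) a b) :
    ∃ j, a = onePos y j ∧ b = onePos y (j + 1) := by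
  obtain ⟨h1, h2, h3, h4⟩ := h
  obtain ⟨j, rfl⟩ := codeSeq_eq_one_iff.1 h2
  obtain ⟨j', rfl⟩ := codeSeq_eq_one_iff.1 h3
  refine ⟨j, rfl, ?_⟩
  have hj := (onePos_strictMono y).lt_iff_lt.1 h1
  rcases Nat.lt_or_ge (j + 1) j' with h | h
  · have := h4 _ (onePos_strictMono y (Nat.lt_succ_self j)) (onePos_strictMono y h)
    rw [codeSeq_onePos] at this
    exact absurd this one_ne_zero
  · rw [show j' = j + 1 by omega]

theorem onePos_succ_sub (y : Cantor) (j : ℕ) :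
    onePos y (j + 1) - onePos y j - 1 = blockLen (pre y (j + 1)) := by
  rw [onePos, blockStart_succ]
  omega

theorem IsGap.unique_right {x : Cantor} {a b b' : ℕ} (h : IsGap x a b) (h' : IsGap x a b') :
    b = b' := by
  obtain ⟨h1, h2, h3, h4⟩ := h
  obtain ⟨h1', h2', h3', h4'⟩ := h'
  rcases lt_trichotomy b b' with hb | hb | hb
  · have := h4' b h1 hb
    rw [h3] at this; exact absurd this one_ne_zero
  · exact hb
  · have := h4 b' h1' hb
    rw [h3'] at this; exact absurd this one_ne_zero

/-- The sequence coding `y`, read from a cut on. -/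
noncomputable def cutSeq (i : ℕ) (t : List ℕ) (y : Cantor) : Cantor :=
  fun n => codeSeq y (cutPos y i t + n)

/-- `n` is the position of the first one of `z`. -/
def IsFirstOne (z : Cantor) (n : ℕ) : Prop := z n = 1 ∧ ∀ m < n, z m = 0

theorem IsFirstOne.unique {z : Cantor} {n n' : ℕ} (h : IsFirstOne z n) (h' : IsFirstOne z n') :
    n = n' := by
  rcases lt_trichotomy n n' with hb | hb | hb
  · have := h'.2 n hb
    rw [h.1] at this; exact absurd this one_ne_zero
  · exact hb
  · have := h.2 n' hb
    rw [h'.1] at this; exact absurd this one_ne_zero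

theorem isFirstOne_cutSeq {i : ℕ} {t : List ℕ} (h : Encodable.encode t ≤ i) (y : Cantor) :
    IsFirstOne (cutSeq i t y) (blockLen (pre y i) - cutLen (pre y i) t) := by
  have h1 := cutPos_lt_onePos y h
  have h2 : cutPos y i t + (blockLen (pre y i) - cutLen (pre y i) t) = onePos y i := by
    unfold cutPos onePos at *
    omega
  refine ⟨by rw [cutSeq, h2]; exact codeSeq_onePos y i, fun m hm => ?_⟩
  exact codeSeq_eq_zero (i := i) ((blockStart_le_cutPos y i t).trans (Nat.le_add_right _ _))
    (by omega)

theorem rest_inj {s s' : List (Fin 2)} {t t' : List ℕ} (h : Encodable.encode t ≤ s.length)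
    (h' : Encodable.encode t' ≤ s'.length)
    (he : blockLen s - cutLen s t = blockLen s' - cutLen s' t') : s = s' ∧ t = t' := by
  have h1 := cutLen_lt_blockLen h
  have h2 := cutLen_lt_blockLen h'
  refine cutLen_add_blockLen_inj (u := s') (u' := s) ?_
  omega

theorem cutSeq_inj {i i' : ℕ} {t t' : List ℕ} {y y' : Cantor} (h : Encodable.encode t ≤ i)
    (h' : Encodable.encode t' ≤ i') (he : cutSeq i t y = cutSeq i' t' y') :
    i = i' ∧ t = t' ∧ y = y' := by
  have h1 := (isFirstOne_cutSeq h y).unique (he ▸ isFirstOne_cutSeq h' y')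
  obtain ⟨h2, rfl⟩ := rest_inj (by simpa using h) (by simpa using h') h1
  obtain ⟨rfl, h3⟩ := pre_eq_pre_iff.1 h2
  refine ⟨rfl, rfl, ?_⟩
  have hcut := cutPos_congr h3 t
  have hshift : ∀ n, cutPos y i t ≤ n → codeSeq y n = codeSeq y' n := fun n hn => by
    obtain ⟨m, rfl⟩ := Nat.exists_eq_add_of_le hn
    have := congrFun he m
    simp only [cutSeq] at this
    rw [this, hcut]
  have key : ∀ m, ∀ j < i + m, y j = y' j := by
    intro m
    induction m with
    | zero => exact h3
    | succ m ih =>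
      have e0 := onePos_congr ih
      have g := isGap_codeSeq y (i + m)
      have g' := isGap_codeSeq y' (i + m)
      rw [← e0] at g'
      have hle : cutPos y i t ≤ onePos y (i + m) :=
        (cutPos_lt_onePos y h).le.trans ((onePos_strictMono y).monotone (by omega))
      have g2 : IsGap (codeSeq y) (onePos y (i + m)) (onePos y' (i + m + 1)) := by
        obtain ⟨a1, a2, a3, a4⟩ := g'
        refine ⟨a1, g.2.1, ?_, fun c hc1 hc2 => ?_⟩
        · rw [hshift _ (by omega)]; exact a3
        · rw [hshift _ (by omega)]; exact a4 c hc1 hc2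
      have e1 := g.unique_right g2
      have e2 := onePos_succ_sub y (i + m)
      rw [e1, e0, onePos_succ_sub y' (i + m)] at e2
      exact (pre_eq_pre_iff.1 (blockLen_injective e2.symm)).2
  ext1 j
  exact key (j + 1) j (by omega)

theorem continuous_of_agree {X : Type*} [TopologicalSpace X] [DiscreteTopology X] {f : Cantor → X}
    (h : ∀ y, ∃ n, ∀ y', (∀ j < n, y' j = y j) → f y' = f y) : Continuous f := by
  refine continuous_discrete_rng.2 fun b => isOpen_iff_mem_nhds.2 fun y hy => ?_
  obtain ⟨n, hn⟩ := h y
  exact Filter.mem_of_superset ((isClopen_agree y n).isOpen.mem_nhds fun _ _ => rfl)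
    fun y' hy' => (hn y' hy').trans hy

theorem continuous_cutSeq (i : ℕ) (t : List ℕ) : Continuous (cutSeq i t) := by
  refine continuous_pi fun n => continuous_of_agree fun y =>
    ⟨i + cutPos y i t + n, fun y' h => ?_⟩
  have e := cutPos_congr (i := i) (fun j hj => h j (by omega)) t
  rw [cutSeq, cutSeq, e]
  refine codeSeq_congr h (le_trans ?_ (onePos_strictMono y').le_apply)
  omega

theorem isClosedEmbedding_cutSeq {i : ℕ} {t : List ℕ} (h : Encodable.encode t ≤ i) :
    IsClosedEmbedding (cutSeq i t) :=
  (continuous_cutSeq i t).isClosedEmbedding fun _ _ he => (cutSeq_inj h h he).2.2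

section Dictionary
variable (𝔽 : Set (Cantor × Cantor × (ℕ → ℕ))) (α : Cantor)

/-- Some point of `𝔽` agrees with `(α, y, β)` on the first `m` coordinates. -/
def IsApprox (y : Cantor) (β : ℕ → ℕ) (m : ℕ) : Prop :=
  ∃ α' y' β', (α', y', β') ∈ 𝔽 ∧ (∀ j < m, α' j = α j) ∧ (∀ j < m, y' j = y j) ∧
    ∀ j < m, β' j = β j

/-- The dictionary coding the section of `𝔽` at `α`. -/
def InDict (w : List (Fin 2)) : Prop :=
  ∃ (y : Cantor) (β : ℕ → ℕ) (k i i' : ℕ), i < i' ∧ Encodable.encode (pre β k) ≤ i ∧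
    Encodable.encode (pre β (k + 1)) ≤ i' ∧ k + 1 ≤ i' ∧ k + 1 ≤ w.length ∧
    w = slice (codeSeq y) (cutPos y i (pre β k)) (cutPos y i' (pre β (k + 1))) ∧
    IsApprox 𝔽 α y β (k + 1)

/-- The part of `x` between `p` and `q` is read in the sequence coding `y`. -/
structure IsEdge (x : Cantor) (p q : ℕ) (y : Cantor) (β : ℕ → ℕ) (k i i' : ℕ) : Prop where
  lt : i < i'
  le : Encodable.encode (pre β k) ≤ i
  le' : Encodable.encode (pre β (k + 1)) ≤ i'
  succ_le : k + 1 ≤ i'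
  approx : IsApprox 𝔽 α y β (k + 1)
  start_lt : p < q
  add_eq : p + cutPos y i' (pre β (k + 1)) = q + cutPos y i (pre β k)
  eq : ∀ j, p + j < q → x (p + j) = codeSeq y (cutPos y i (pre β k) + j)

variable {𝔽 α}

theorem IsApprox.congr {y y' : Cantor} {β β' : ℕ → ℕ} {m m' : ℕ} (h : IsApprox 𝔽 α y β m)
    (hm : m' ≤ m) (hy : ∀ j < m', y j = y' j) (hβ : ∀ j < m', β j = β' j) :
    IsApprox 𝔽 α y' β' m' := by
  obtain ⟨a, b, c, h0, h1, h2, h3⟩ := h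
  exact ⟨a, b, c, h0, fun j hj => h1 j (by omega), fun j hj => (h2 j (by omega)).trans (hy j hj),
    fun j hj => (h3 j (by omega)).trans (hβ j hj)⟩

theorem mem_of_isApprox (h𝔽 : IsClosed 𝔽) {y : Cantor} {β : ℕ → ℕ}
    (h : ∀ m, IsApprox 𝔽 α y β m) : (α, y, β) ∈ 𝔽 := by
  by_contra hn
  obtain ⟨U, V, hU, hV, hαU, hV', hUV⟩ := isOpen_prod_iff.1 h𝔽.isOpen_compl _ _ hn
  obtain ⟨V, W, hV, hW, hyV, hβW, hVW⟩ := isOpen_prod_iff.1 hV _ _ hV'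
  obtain ⟨m1, h1⟩ := hU.exists_agree_subset hαU
  obtain ⟨m2, h2⟩ := hV.exists_agree_subset hyV
  obtain ⟨m3, h3⟩ := hW.exists_agree_subset hβW
  obtain ⟨a, b, c, h0, ha, hb, hc⟩ := h (m1 + m2 + m3)
  exact hUV (Set.mk_mem_prod (h1 a fun j hj => ha j (by omega)) (hVW (Set.mk_mem_prod
    (h2 b fun j hj => hb j (by omega)) (h3 c fun j hj => hc j (by omega))))) h0

theorem cutPos_lt_cutPos (y : Cantor) {i i' : ℕ} {t t' : List ℕ} (h : i < i')
    (ht : Encodable.encode t ≤ i) (m : ℕ) (hm : i + m < i') :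
    cutPos y i t + m + 1 < cutPos y i' t' := by
  have h1 := cutPos_lt_onePos y ht
  obtain ⟨d, rfl⟩ := Nat.exists_eq_add_of_lt h
  have h2 : onePos y (i + d) + 1 ≤ cutPos y (i + d + 1) t' := blockStart_le_cutPos y (i + d + 1) t'
  have h3 : ∀ d, onePos y i + d ≤ onePos y (i + d) := fun d => by
    induction d with
    | zero => rfl
    | succ d ih =>
      have := onePos_strictMono y (show i + d < i + (d + 1) by omega)
      omega
  have := h3 d
  omega

theorem inDict_nil : ¬ InDict 𝔽 α [] := by
  rintro ⟨y, β, k, i, i', -, -, -, -, h, -⟩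
  simp at h

theorem InDict.exists_isEdge {x : Cantor} {p q : ℕ} (h : InDict 𝔽 α (slice x p q)) :
    ∃ y β k i i', IsEdge 𝔽 α x p q y β k i i' := by
  obtain ⟨y, β, k, i, i', h1, h2, h3, h4, h5, h6, h7⟩ := h
  obtain ⟨h8, h9⟩ := pre_eq_pre_iff.1 h6
  rw [length_slice] at h5
  have := cutPos_lt_cutPos y (t' := pre β (k + 1)) h1 h2 0 (by omega)
  exact ⟨y, β, k, i, i', h1, h2, h3, h4, h7, by omega, by omega,
    fun j hj => h9 j (by omega)⟩

variable {x : Cantor} {p q : ℕ} {y : Cantor} {β : ℕ → ℕ} {k i i' : ℕ}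

theorem IsEdge.gap_mem (h : IsEdge 𝔽 α x p q y β k i i') {a b : ℕ} (ha : p ≤ a) (hb : b < q)
    (hab : IsGap x a b) : b - a - 1 ∈ Set.range blockLen := by
  obtain ⟨a, rfl⟩ := Nat.exists_eq_add_of_le ha
  obtain ⟨h1, h2, h3, h4⟩ := hab
  obtain ⟨b, rfl⟩ := Nat.exists_eq_add_of_le (ha.trans h1.le)
  have hg : IsGap (codeSeq y) (cutPos y i (pre β k) + a) (cutPos y i (pre β k) + b) := by
    refine ⟨by omega, by rw [← h.eq _ (by omega)]; exact h2,
      by rw [← h.eq _ (by omega)]; exact h3, fun c hc1 hc2 => ?_⟩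
    obtain ⟨c, rfl⟩ := Nat.exists_eq_add_of_le ((Nat.le_add_right _ _).trans hc1.le)
    rw [← h.eq _ (by omega)]
    exact h4 _ (by omega) (by omega)
  obtain ⟨j, hj1, hj2⟩ := hg.codeSeq_eq
  refine ⟨pre y (j + 1), ?_⟩
  rw [← onePos_succ_sub]
  omega

theorem IsEdge.exists_gap {u : ℕ} {y₂ : Cantor} {β₂ : ℕ → ℕ} {k₂ i₂ i₂' : ℕ}
    (h : IsEdge 𝔽 α x p q y β k i i') (h' : IsEdge 𝔽 α x q u y₂ β₂ k₂ i₂ i₂') :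
    ∃ a b, q ≤ b ∧ IsGap x a b ∧ b - a - 1 = cutLen (pre y i') (pre β (k + 1)) +
      (blockLen (pre y₂ i₂) - cutLen (pre y₂ i₂) (pre β₂ k₂)) := by
  obtain ⟨d, rfl⟩ := Nat.exists_eq_add_of_lt h.lt
  have e1 := h.add_eq
  have e2 := h'.add_eq
  have c1 := cutPos_lt_onePos y h.le
  have c2 := (onePos_strictMono y).monotone (show i ≤ i + d by omega)
  have c3 := blockStart_le_cutPos y (i + d + 1) (pre β (k + 1))
  have c3' := blockStart_succ y (i + d)
  have c4 := cutPos_lt_onePos y h.le'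
  have c5 := cutPos_lt_onePos y₂ h'.le
  have c6 := blockStart_le_cutPos y₂ i₂ (pre β₂ k₂)
  have c7 : onePos y₂ i₂ < cutPos y₂ i₂' (pre β₂ (k₂ + 1)) := by
    obtain ⟨d', rfl⟩ := Nat.exists_eq_add_of_lt h'.lt
    have c2 := (onePos_strictMono y₂).monotone (show i₂ ≤ i₂ + d' by omega)
    have c3 := blockStart_le_cutPos y₂ (i₂ + d' + 1) (pre β₂ (k₂ + 1))
    have c3' := blockStart_succ y₂ (i₂ + d')
    omega
  refine ⟨p + (onePos y (i + d) - cutPos y i (pre β k)),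
    q + (onePos y₂ i₂ - cutPos y₂ i₂ (pre β₂ k₂)), by omega, ⟨by omega, ?_, ?_, ?_⟩, ?_⟩
  · rw [h.eq _ (by omega), Nat.add_sub_cancel' (by omega)]
    exact codeSeq_onePos _ _
  · rw [h'.eq _ (by omega), Nat.add_sub_cancel' (by omega)]
    exact codeSeq_onePos _ _
  · intro c hc1 hc2
    rcases Nat.lt_or_ge c q with hc | hc
    · obtain ⟨c, rfl⟩ := Nat.exists_eq_add_of_le ((Nat.le_add_right _ _).trans hc1.le)
      rw [h.eq _ hc]
      exact codeSeq_eq_zero (i := i + d + 1) (by omega) (by omega)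
    · obtain ⟨c, rfl⟩ := Nat.exists_eq_add_of_le hc
      rw [h'.eq _ (by omega)]
      exact codeSeq_eq_zero (i := i₂) (by omega) (by omega)
  · unfold cutPos onePos at *
    omega

theorem IsEdge.eq_of_gap {u : ℕ} {y₂ : Cantor} {β₂ : ℕ → ℕ} {k₂ i₂ i₂' : ℕ}
    (h : IsEdge 𝔽 α x p q y β k i i') (h' : IsEdge 𝔽 α x q u y₂ β₂ k₂ i₂ i₂')
    (hgood : ∀ a b, q ≤ b → IsGap x a b → b - a - 1 ∈ Set.range blockLen) :
    pre y i' = pre y₂ i₂ ∧ pre β (k + 1) = pre β₂ k₂ := by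
  obtain ⟨a, b, h1, h2, h3⟩ := h.exists_gap h'
  obtain ⟨v, hv⟩ := hgood a b h1 h2
  have := cutLen_lt_blockLen (s := pre y₂ i₂) (t := pre β₂ k₂) (by simpa using h'.le)
  refine cutLen_add_blockLen_inj (u := pre y₂ i₂) (u' := v) ?_
  omega

theorem exists_glue {A : Type*} (f : ℕ → ℕ → A) {l : ℕ → ℕ} (hl : StrictMono l)
    (h : ∀ n, ∀ j < l (n + 1), f n j = f (n + 1) j) :
    ∃ g : ℕ → A, ∀ n, ∀ j < l (n + 1), f n j = g j := by
  have key : ∀ d n j, j < l (n + 1) → f n j = f (n + d) j := fun d => by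
    induction d with
    | zero => exact fun _ _ _ => rfl
    | succ d ih =>
      intro n j hj
      rw [ih n j hj, ← add_assoc]
      exact h _ _ (hj.trans_le (hl.monotone (by omega)))
  refine ⟨fun j => f j j, fun n j hj => ?_⟩
  have hj' : j < l (j + 1) := hl.le_apply
  rcases le_total n j with hnj | hnj
  · obtain ⟨d, rfl⟩ := Nat.exists_eq_add_of_le hnj
    exact key d n _ hj
  · obtain ⟨d, rfl⟩ := Nat.exists_eq_add_of_le hnj
    exact (key d j _ hj').symm

variable (𝔽 α) in
/-- The codes, from a cut on, of the points of the projection of `𝔽` at `α`. -/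
def codeSet : Set Cantor :=
  {z | ∃ i y β k, Encodable.encode (pre β k) ≤ i ∧ (α, y, β) ∈ 𝔽 ∧ z = cutSeq i (pre β k) y}

theorem shift_mem_codeSet (h𝔽 : IsClosed 𝔽) {p : ℕ → ℕ}
    (hp : ∀ n, InDict 𝔽 α (slice x (p n) (p (n + 1))))
    (hgood : ∀ a b, p 1 ≤ b → IsGap x a b → b - a - 1 ∈ Set.range blockLen) :
    (fun n => x (p 0 + n)) ∈ codeSet 𝔽 α := by
  choose y β k i i' h using fun n => (hp n).exists_isEdge
  have hmono : StrictMono p := strictMono_nat_of_lt_succ fun n => (h n).start_lt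
  have hj : ∀ n, pre (y n) (i' n) = pre (y (n + 1)) (i (n + 1)) ∧
      pre (β n) (k n + 1) = pre (β (n + 1)) (k (n + 1)) := fun n =>
    (h n).eq_of_gap (h (n + 1)) fun a b hb => hgood a b
      ((hmono.monotone (by omega : 1 ≤ n + 1)).trans hb)
  have hi : ∀ n, i' n = i (n + 1) := fun n => (pre_eq_pre_iff.1 (hj n).1).1
  have hk : ∀ n, k n + 1 = k (n + 1) := fun n => (pre_eq_pre_iff.1 (hj n).2).1
  have hy' : ∀ n, ∀ j < i (n + 1), y n j = y (n + 1) j := fun n => by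
    rw [← hi]; exact (pre_eq_pre_iff.1 (hj n).1).2
  have hβ' : ∀ n, ∀ j < k (n + 1), β n j = β (n + 1) j := fun n => by
    rw [← hk]; exact (pre_eq_pre_iff.1 (hj n).2).2
  have him : StrictMono i := strictMono_nat_of_lt_succ fun n => by rw [← hi]; exact (h n).lt
  have hkm : StrictMono k := strictMono_nat_of_lt_succ fun n => by rw [← hk]; omega
  obtain ⟨Y, hY⟩ := exists_glue y him hy'
  obtain ⟨b, hb⟩ := exists_glue β hkm hβ'
  have hpre : ∀ n, pre (β n) (k n) = pre b (k n) := fun n =>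
    pre_eq_pre_iff.2 ⟨rfl, fun j hj => hb n j (hj.trans (hkm (Nat.lt_succ_self n)))⟩
  have hpre' : ∀ n, pre (β n) (k n + 1) = pre b (k (n + 1)) := fun n => by
    rw [(hj n).2, hpre]
  have hcut : ∀ n, cutPos (y n) (i n) (pre (β n) (k n)) = cutPos Y (i n) (pre b (k n)) := fun n => by
    rw [hpre]
    exact cutPos_congr (fun j hj => hY n j (hj.trans (him (Nat.lt_succ_self n)))) _
  have hcut' : ∀ n, cutPos (y n) (i' n) (pre (β n) (k n + 1)) =
      cutPos Y (i (n + 1)) (pre b (k (n + 1))) := fun n => by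
    rw [hpre', hi]
    exact cutPos_congr (hY n) _
  have hpos : ∀ n, p n + cutPos Y (i 0) (pre b (k 0)) = p 0 + cutPos Y (i n) (pre b (k n)) := by
    intro n
    induction n with
    | zero => rfl
    | succ n ih =>
      have := (h n).add_eq
      rw [hcut, hcut'] at this
      omega
  refine ⟨i 0, Y, b, k 0, by rw [← hpre]; exact (h 0).le, mem_of_isApprox h𝔽 fun m => ?_, ?_⟩
  · have h1 : m ≤ k m := hkm.le_apply
    have h2 := (h m).succ_le
    have h3 := hk m
    have h4 := hi m
    exact (h m).approx.congr (by omega) (fun j hj => hY m j (by omega))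
      fun j hj => hb m j (by omega)
  · ext1 m
    have hex : ∃ n, p 0 + m < p (n + 1) :=
      ⟨p 0 + m, (Nat.lt_succ_self _).trans_le hmono.le_apply⟩
    classical
    have hlt := Nat.find_spec hex
    have hle : p (Nat.find hex) ≤ p 0 + m := by
      rcases hn : Nat.find hex with _ | n
      · omega
      · exact not_lt.1 (Nat.find_min hex (by omega : n < Nat.find hex))
    revert hlt hle
    generalize Nat.find hex = n
    intro hlt hle
    obtain ⟨d, hd⟩ := Nat.exists_eq_add_of_le hle
    have e := (h n).eq d (by omega)
    have e2 := hpos n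
    have e3 := (h n).add_eq
    rw [hcut] at e e3
    rw [hcut'] at e3
    have e4 := cutPos_lt_onePos Y (i := i (n + 1)) (t := pre b (k (n + 1))) (by
      rw [← hpre' n, ← hi n]; exact (h n).le')
    simp only [cutSeq]
    rw [hd, e, show cutPos Y (i 0) (pre b (k 0)) + m = cutPos Y (i n) (pre b (k n)) + d by omega]
    refine codeSeq_congr (hY n) ?_
    rw [onePos_congr (hY n)]
    omega

variable (𝔽 α) in
/-- An infinite factorization of `x` over the dictionary starts at `q`. -/
def HasPath (x : Cantor) (q : ℕ) : Prop :=
  ∃ p : ℕ → ℕ, p 0 = q ∧ ∀ n, InDict 𝔽 α (slice x (p n) (p (n + 1)))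

variable (𝔽 α) in
/-- The prefix of `x` of length `q` factorizes over the dictionary. -/
def Reach (x : Cantor) (q : ℕ) : Prop :=
  Relation.ReflTransGen (fun a b => InDict 𝔽 α (slice x a b)) 0 q

theorem mem_omegaPower_iff_hasPath :
    x ∈ omegaPower {w | InDict 𝔽 α w} ↔ HasPath 𝔽 α x 0 :=
  mem_omegaPower_iff inDict_nil

theorem HasPath.of_reach {q : ℕ} (h : Reach 𝔽 α x q) (hq : HasPath 𝔽 α x q) :
    HasPath 𝔽 α x 0 := by
  have key : ∀ a, Relation.ReflTransGen (fun a b => InDict 𝔽 α (slice x a b)) a q →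
      HasPath 𝔽 α x a := by
    intro a ha
    induction ha using Relation.ReflTransGen.head_induction_on with
    | refl => exact hq
    | head h _ ih =>
      obtain ⟨p, rfl, hp⟩ := ih
      rename_i a _
      refine ⟨fun n => Nat.casesOn (motive := fun _ => ℕ) n a p, rfl, fun n => ?_⟩
      cases n with
      | zero => exact h
      | succ n => exact hp n
  exact key 0 h

theorem HasPath.of_shift_mem {q : ℕ} (h : (fun n => x (q + n)) ∈ codeSet 𝔽 α) :
    HasPath 𝔽 α x q := by
  obtain ⟨i, y, β, k, h1, h2, h3⟩ := h
  let I : ℕ → ℕ := fun n => Nat.rec (motive := fun _ => ℕ) i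
    (fun n m => m + 1 + Encodable.encode (pre β (k + n + 1)) + (k + n + 1)) n
  have hI : ∀ n, I (n + 1) = I n + 1 + Encodable.encode (pre β (k + n + 1)) + (k + n + 1) :=
    fun n => rfl
  have hle : ∀ n, Encodable.encode (pre β (k + n)) ≤ I n := fun n => by
    cases n with
    | zero => exact h1
    | succ n => rw [hI, ← add_assoc]; omega
  let C : ℕ → ℕ := fun n => cutPos y (I n) (pre β (k + n))
  have hC : ∀ n, C n + (k + n + 1) < C (n + 1) := fun n => by
    have := cutPos_lt_cutPos y (i := I n) (i' := I (n + 1)) (t := pre β (k + n))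
      (t' := pre β (k + (n + 1))) (by rw [hI]; omega) (hle n) (k + n + 1) (by rw [hI]; omega)
    change cutPos y (I n) (pre β (k + n)) + (k + n + 1) < cutPos y (I (n + 1)) (pre β (k + (n + 1)))
    omega
  have hC0 : ∀ n, C 0 ≤ C n := fun n => monotone_nat_of_le_succ
    (fun n => by have := hC n; omega) (Nat.zero_le n)
  refine ⟨fun n => q + (C n - C 0), by simp, fun n => ?_⟩
  have a1 := hC n
  have a2 := hC0 n
  have a3 := hC0 (n + 1)
  dsimp only
  refine ⟨y, β, k + n, I n, I (n + 1), by rw [hI]; omega, hle n, hle (n + 1), by rw [hI]; omega,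
    by rw [length_slice]; omega, ?_, α, y, β, h2, fun _ _ => rfl, fun _ _ => rfl, fun _ _ => rfl⟩
  change _ = slice (codeSeq y) (C n) (C (n + 1))
  refine slice_eq_slice (by omega) fun j hj => ?_
  have := congrFun h3 (C n - C 0 + j)
  rw [add_assoc, this]
  change codeSeq y (C 0 + _) = _
  rw [← add_assoc, Nat.add_sub_cancel' a2]

/-- Position `b` ends a gap whose length is not the length of a block. -/
def IsBad (x : Cantor) (b : ℕ) : Prop := ∃ a, IsGap x a b ∧ b - a - 1 ∉ Set.range blockLen

theorem InDict.start_lt {x : Cantor} {p q : ℕ} (h : InDict 𝔽 α (slice x p q)) : p < q := by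
  obtain ⟨y, β, k, i, i', h⟩ := h.exists_isEdge
  exact h.start_lt

theorem hasPath_iff_of_good (h𝔽 : IsClosed 𝔽) {k : ℕ} (hx : ∀ b, k ≤ b → ¬ IsBad x b) :
    HasPath 𝔽 α x 0 ↔ ∃ q ≤ k, Reach 𝔽 α x q ∧ (fun n => x (q + n)) ∈ codeSet 𝔽 α := by
  classical
  constructor
  · rintro ⟨p, hp0, hp⟩
    have hmono : StrictMono p := strictMono_nat_of_lt_succ fun n => (hp n).start_lt
    have hreach : ∀ n, Reach 𝔽 α x (p n) := fun n => by
      induction n with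
      | zero => rw [hp0]; exact .refl
      | succ n ih => exact .tail ih (hp n)
    have hex : ∃ n, k < p (n + 1) := ⟨k, (Nat.lt_succ_self _).trans_le hmono.le_apply⟩
    have hlt := Nat.find_spec hex
    have hle : p (Nat.find hex) ≤ k := by
      rcases hn : Nat.find hex with _ | n
      · omega
      · exact not_lt.1 (Nat.find_min hex (by omega : n < Nat.find hex))
    refine ⟨_, hle, hreach _, shift_mem_codeSet h𝔽 (p := fun n => p (Nat.find hex + n))
      (fun n => hp _) fun a b hb hab => ?_⟩
    by_contra hn
    exact hx b (hlt.le.trans hb) ⟨a, hab, hn⟩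
  · rintro ⟨q, -, h1, h2⟩
    exact .of_reach h1 (.of_shift_mem h2)

theorem hasPath_iff_of_bad (hx : ∀ k, ∃ b ≥ k, IsBad x b) :
    HasPath 𝔽 α x 0 ↔ ∀ k, ∃ q ≥ k, Reach 𝔽 α x q := by
  constructor
  · rintro ⟨p, hp0, hp⟩ k
    have hmono : StrictMono p := strictMono_nat_of_lt_succ fun n => (hp n).start_lt
    have hreach : ∀ n, Reach 𝔽 α x (p n) := fun n => by
      induction n with
      | zero => rw [hp0]; exact .refl
      | succ n ih => exact .tail ih (hp n)
    exact ⟨p k, hmono.le_apply, hreach k⟩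
  · intro h
    have hbound : ∀ p, ∃ b, ∀ q, InDict 𝔽 α (slice x p q) → q ≤ b := by
      intro p
      obtain ⟨b₁, hb₁, a₁, ⟨-, -, hone, -⟩, -⟩ := hx p
      obtain ⟨b, hb, a, hab, hbad⟩ := hx (b₁ + 1)
      refine ⟨b, fun q hq => ?_⟩
      by_contra hlt
      obtain ⟨y, β, k, i, i', he⟩ := hq.exists_isEdge
      refine hbad (he.gap_mem ?_ (by omega) hab)
      by_contra hap
      have := hab.2.2.2 b₁ (by omega) (by omega)
      rw [hone] at this
      exact one_ne_zero this
    let R : ℕ → ℕ → Prop := fun a b => InDict 𝔽 α (slice x a b)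
    let G : ℕ → Set ℕ := fun p => {q | Relation.ReflTransGen R p q}
    have hstep : ∀ p, (G p).Infinite → ∃ q, R p q ∧ (G q).Infinite := by
      intro p hp
      by_contra! hn
      obtain ⟨b, hb⟩ := hbound p
      have hfin : {q | R p q}.Finite := (Set.finite_Iic b).subset hb
      refine hp (((Set.finite_singleton p).union (hfin.biUnion (t := G) fun q hq =>
        hn q hq)).subset fun r hr => ?_)
      rcases Relation.ReflTransGen.cases_head hr with rfl | ⟨q, h1, h2⟩
      · exact Or.inl rfl
      · exact Or.inr (Set.mem_biUnion h1 h2)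
    have h0 : (G 0).Infinite := Set.infinite_of_forall_exists_gt fun k => by
      obtain ⟨q, h1, h2⟩ := h (k + 1)
      exact ⟨q, h2, h1⟩
    choose! s hs1 hs2 using hstep
    have hinf : ∀ n, (G (s^[n] 0)).Infinite := fun n => by
      induction n with
      | zero => exact h0
      | succ n ih => rw [Function.iterate_succ_apply']; exact hs2 _ ih
    refine ⟨fun n => s^[n] 0, rfl, fun n => ?_⟩
    change InDict 𝔽 α (slice x (s^[n] 0) (s^[n + 1] 0))
    rw [Function.iterate_succ_apply']
    exact hs1 _ (hinf n)

theorem not_isBad_cutSeq (i : ℕ) (t : List ℕ) (y : Cantor) (b : ℕ) : ¬ IsBad (cutSeq i t y) b := by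
  rintro ⟨a, ⟨h1, h2, h3, h4⟩, hn⟩
  have hg : IsGap (codeSeq y) (cutPos y i t + a) (cutPos y i t + b) := by
    refine ⟨by omega, h2, h3, fun c hc1 hc2 => ?_⟩
    obtain ⟨c, rfl⟩ := Nat.exists_eq_add_of_le ((Nat.le_add_right _ _).trans hc1.le)
    exact h4 c (by omega) (by omega)
  obtain ⟨j, hj1, hj2⟩ := hg.codeSeq_eq
  refine hn ⟨pre y (j + 1), ?_⟩
  rw [← onePos_succ_sub]
  omega

theorem cutSeq_mem_omegaPower_iff (h𝔽 : IsClosed 𝔽) :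
    cutSeq 0 [] y ∈ omegaPower {w | InDict 𝔽 α w} ↔ ∃ β, (α, y, β) ∈ 𝔽 := by
  have h0 : Encodable.encode ([] : List ℕ) ≤ 0 := by simp
  rw [mem_omegaPower_iff_hasPath, hasPath_iff_of_good h𝔽 (k := 0) fun b _ => not_isBad_cutSeq _ _ _ b]
  constructor
  · rintro ⟨q, hq, -, i, y', β, k, h1, h2, h3⟩
    obtain rfl : q = 0 := by omega
    simp only [zero_add] at h3
    obtain ⟨-, -, rfl⟩ := cutSeq_inj h0 h1 h3
    exact ⟨β, h2⟩
  · rintro ⟨β, hβ⟩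
    refine ⟨0, le_rfl, .refl, 0, y, β, 0, h0, hβ, ?_⟩
    simp only [zero_add]
    rfl

end Dictionary

theorem isClopen_of_agree {S : Set Cantor} (n : ℕ)
    (h : ∀ x ∈ S, ∀ x', (∀ j < n, x' j = x j) → x' ∈ S) : IsClopen S := by
  constructor
  · refine isOpen_compl_iff.1 (isOpen_iff_mem_nhds.2 fun x hx => ?_)
    exact Filter.mem_of_superset ((isClopen_agree x n).isOpen.mem_nhds fun _ _ => rfl)
      fun x' hx' hS => hx (h x' hS x fun j hj => (hx' j hj).symm)
  · refine isOpen_iff_mem_nhds.2 fun x hx => ?_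
    exact Filter.mem_of_superset ((isClopen_agree x n).isOpen.mem_nhds fun _ _ => rfl)
      fun x' hx' => h x hx x' hx'

theorem isClopen_isBad (b : ℕ) : IsClopen {x | IsBad x b} := by
  refine isClopen_of_agree (b + 1) ?_
  rintro x ⟨a, ⟨h1, h2, h3, h4⟩, hn⟩ x' hx'
  exact ⟨a, ⟨h1, by rw [hx' a (by omega)]; exact h2, by rw [hx' b (by omega)]; exact h3,
    fun c hc1 hc2 => by rw [hx' c (by omega)]; exact h4 c hc1 hc2⟩, hn⟩

theorem isClopen_isFirstOne (n : ℕ) : IsClopen {z | IsFirstOne z n} := by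
  refine isClopen_of_agree (n + 1) ?_
  rintro x ⟨h1, h2⟩ x' hx'
  exact ⟨by rw [hx' n (by omega)]; exact h1,
    fun c hc => by rw [hx' c (by omega)]; exact h2 c hc⟩

theorem isClopen_reach (𝔽 : Set (Cantor × Cantor × (ℕ → ℕ))) (α : Cantor) (q : ℕ) :
    IsClopen {x | Reach 𝔽 α x q} := by
  refine isClopen_of_agree q fun x hx => ?_
  change Reach 𝔽 α x q at hx
  unfold Reach at hx
  induction hx with
  | refl => exact fun x' _ => .refl
  | tail _ h ih =>
    intro x' hx'
    have hlt := InDict.start_lt h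
    refine .tail (ih x' fun j hj => hx' j (by omega)) ?_
    rw [slice_eq_slice (y := x) rfl fun j hj => hx' _ (by omega)]
    exact h

/-- The closure properties of a Borel class needed to transfer membership to ω-powers. -/
structure IsNiceClass (Γ : Set (Set Cantor)) : Prop where
  union : ∀ {s t}, s ∈ Γ → t ∈ Γ → s ∪ t ∈ Γ
  inter : ∀ {s t}, s ∈ Γ → t ∈ Γ → s ∩ t ∈ Γ
  isClosed : ∀ {s}, IsClosed s → s ∈ Γ
  isGδ : ∀ {s}, IsGδ s → s ∈ Γ
  preimage : ∀ {s} {f : Cantor → Cantor}, Continuous f → s ∈ Γ → f ⁻¹' s ∈ Γ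
  exists_preimage_eq : ∀ {s} {f : Cantor → Cantor}, IsInducing f → s ∈ Γ → ∃ t ∈ Γ, f ⁻¹' t = s
  cover : ∀ {ι : Type} [Countable ι] {M S : ι → Set Cantor} {A : Set Cantor}, (∀ i, IsGδ (M i)) →
    (∀ x, ∃ i, x ∈ M i) → (∀ i, S i ∈ Γ) → (∀ i, ∀ x ∈ M i, (x ∈ A ↔ x ∈ S i)) → A ∈ Γ

theorem IsClosed.isGδ_cantor {s : Set Cantor} (hs : IsClosed s) : IsGδ s := by
  let := metrizableSpaceMetric Cantor
  exact hs.isGδ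

theorem IsGδ.mem_sigmaZero {ξ : Ordinal.{0}} (hξ : 3 ≤ ξ) {s : Set Cantor} (hs : IsGδ s) :
    s ∈ SigmaZero Cantor ξ := by
  obtain ⟨f, hf, rfl⟩ := isGδ_iff_eq_iInter_nat.1 hs
  exact iInter_isOpen_mem_sigmaZero hξ hf

theorem isNiceClass_sigmaZero {ξ : Ordinal.{0}} (hξ : 3 ≤ ξ) :
    IsNiceClass (SigmaZero Cantor ξ) where
  union := sigmaZero_union
  inter := sigmaZero_inter
  isClosed h := h.isGδ_cantor.mem_sigmaZero hξ
  isGδ h := h.mem_sigmaZero hξ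
  preimage hf hs := sigmaZero_preimage hf hs
  exists_preimage_eq hf hs := exists_sigmaZero_preimage_eq hf hs
  cover hM hcov hS hA := sigmaZero_of_cover (fun i => (hM i).mem_sigmaZero hξ) hcov hS hA

theorem isNiceClass_piZero {ξ : Ordinal.{0}} (hξ : 3 ≤ ξ) : IsNiceClass (PiZero Cantor ξ) where
  union := piZero_union
  inter {s t} hs ht := by
    change (s ∩ t)ᶜ ∈ SigmaZero Cantor ξ
    rw [Set.compl_inter]
    exact sigmaZero_union hs ht
  isClosed h := isOpen_mem_sigmaZero h.isOpen_compl
  isGδ {s} h := by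
    obtain ⟨f, hf, rfl⟩ := isGδ_iff_eq_iInter_nat.1 h
    change (⋂ n, f n)ᶜ ∈ SigmaZero Cantor ξ
    rw [Set.compl_iInter]
    exact sigmaZero_iUnion fun n => (hf n).isClosed_compl.isGδ_cantor.mem_sigmaZero hξ
  preimage hf hs := piZero_preimage hf hs
  exists_preimage_eq {s f} hf hs := by
    obtain ⟨t, ht, h⟩ := exists_sigmaZero_preimage_eq hf hs
    exact ⟨tᶜ, by rwa [PiZero, Set.mem_ofPred_eq, compl_compl],
      by rw [Set.preimage_compl, h, compl_compl]⟩
  cover hM hcov hS hA := piZero_of_cover (fun i => (hM i).mem_sigmaZero hξ) hcov hS hA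

section
variable {Γ : Set (Set Cantor)} {𝔽 : Set (Cantor × Cantor × (ℕ → ℕ))} {α : Cantor}

theorem IsNiceClass.codeSet_mem (hΓ : IsNiceClass Γ) (h : ∀ (a : Set ℕ) (β₀ : ℕ → ℕ),
    {y | ∃ β, (∀ i ∈ a, β i = β₀ i) ∧ (α, y, β) ∈ 𝔽} ∈ Γ) : codeSet 𝔽 α ∈ Γ := by
  classical
  let P : List ℕ → Set Cantor := fun t => {y | ∃ β, pre β t.length = t ∧ (α, y, β) ∈ 𝔽}
  have hP : ∀ t, P t ∈ Γ := fun t => by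
    convert h {i | i < t.length} (fun i => t.getD i 0) using 1
    ext y
    refine exists_congr fun β => and_congr_left fun _ => ?_
    constructor
    · intro ht i hi
      have hi : i < t.length := hi
      have : t.getD i 0 = (pre β t.length).getD i 0 := by rw [ht]
      rw [this]
      simp [pre, hi]
    · intro ht
      refine List.ext_getElem (by simp) fun i h1 h2 => ?_
      have := ht i h2
      simp [pre, this, h2]
  let V : ℕ × List ℕ → Set Cantor := fun σ => {z | Encodable.encode σ.2 ≤ σ.1 ∧
    ∃ s : List (Fin 2), s.length = σ.1 ∧ IsFirstOne z (blockLen s - cutLen s σ.2)}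
  have hV : ∀ σ, IsOpen (V σ) := fun σ => by
    have : V σ = {z | Encodable.encode σ.2 ≤ σ.1} ∩ ⋃ s : {s : List (Fin 2) // s.length = σ.1},
        {z | IsFirstOne z (blockLen s.1 - cutLen s.1 σ.2)} := by
      ext z; simp [V]
    rw [this]
    exact isOpen_const.inter (isOpen_iUnion fun s => (isClopen_isFirstOne _).isOpen)
  have hVmem : ∀ i (t : List ℕ) (y : Cantor), Encodable.encode t ≤ i → cutSeq i t y ∈ V (i, t) :=
    fun i t y ht => ⟨ht, pre y i, by simp, isFirstOne_cutSeq ht y⟩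
  have hVinj : ∀ σ τ z, z ∈ V σ → z ∈ V τ → σ = τ := by
    rintro ⟨i, t⟩ ⟨i', t'⟩ z ⟨h1, s, hs, h2⟩ ⟨h1', s', hs', h2'⟩
    obtain ⟨rfl, rfl⟩ := rest_inj (hs ▸ h1) (hs' ▸ h1') (h2.unique h2')
    exact Prod.ext (hs.symm.trans hs') rfl
  have hS : ∀ σ : ℕ × List ℕ, ∃ S ∈ Γ, ∀ z ∈ V σ, (z ∈ codeSet 𝔽 α ↔ z ∈ S) := by
    rintro ⟨i, t⟩
    by_cases ht : Encodable.encode t ≤ i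
    · have hc := isClosedEmbedding_cutSeq ht
      obtain ⟨T, hT, hTe⟩ := hΓ.exists_preimage_eq hc.isInducing (hP t)
      refine ⟨T ∩ Set.range (cutSeq i t), hΓ.inter hT (hΓ.isClosed hc.isClosed_range),
        fun z hz => ⟨?_, ?_⟩⟩
      · rintro ⟨i', y, β, k, h1, h2, rfl⟩
        have := hVinj _ _ _ hz (hVmem i' (pre β k) y h1)
        rw [Prod.mk.injEq] at this
        obtain ⟨rfl, rfl⟩ := this
        refine ⟨?_, y, rfl⟩
        change y ∈ cutSeq i (pre β k) ⁻¹' T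
        rw [hTe]
        exact ⟨β, by simp, h2⟩
      · rintro ⟨hzT, y, rfl⟩
        have : y ∈ P t := hTe ▸ hzT
        obtain ⟨β, h1, h2⟩ := this
        exact ⟨i, y, β, t.length, by rwa [h1], h2, by rw [h1]⟩
    · exact ⟨∅, hΓ.isClosed isClosed_empty, fun z hz => absurd hz.1 ht⟩
  choose S hS hSV using hS
  refine hΓ.cover (ι := Option (ℕ × List ℕ)) (M := fun o => o.elim (⋃ σ, V σ)ᶜ V)
    (S := fun o => o.elim ∅ S) ?_ ?_ ?_ ?_
  · rintro (_ | σ)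
    · exact (isOpen_iUnion hV).isClosed_compl.isGδ_cantor
    · exact (hV σ).isGδ
  · intro z
    by_cases hz : z ∈ ⋃ σ, V σ
    · obtain ⟨σ, hσ⟩ := Set.mem_iUnion.1 hz
      exact ⟨some σ, hσ⟩
    · exact ⟨none, hz⟩
  · rintro (_ | σ)
    · exact hΓ.isClosed isClosed_empty
    · exact hS σ
  · rintro (_ | σ) z hz
    · refine ⟨?_, fun h => h.elim⟩
      rintro ⟨i, y, β, k, h1, h2, rfl⟩
      exact hz (Set.mem_iUnion.2 ⟨_, hVmem _ _ _ h1⟩)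
    · exact hSV σ z hz

theorem IsNiceClass.omegaPower_mem (hΓ : IsNiceClass Γ) (h𝔽 : IsClosed 𝔽)
    (h : ∀ (a : Set ℕ) (β₀ : ℕ → ℕ), {y | ∃ β, (∀ i ∈ a, β i = β₀ i) ∧ (α, y, β) ∈ 𝔽} ∈ Γ) :
    omegaPower {w | InDict 𝔽 α w} ∈ Γ := by
  have hZ := hΓ.codeSet_mem h
  have hfin : ∀ k, {x | ∃ q ≤ k, Reach 𝔽 α x q ∧ (fun n => x (q + n)) ∈ codeSet 𝔽 α} ∈ Γ := by
    have h1 : ∀ q, {x | Reach 𝔽 α x q ∧ (fun n => x (q + n)) ∈ codeSet 𝔽 α} ∈ Γ := fun q =>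
      hΓ.inter (hΓ.isClosed (isClopen_reach 𝔽 α q).isClosed)
        (hΓ.preimage (f := fun x n => x (q + n)) (by fun_prop) hZ)
    intro k
    induction k with
    | zero =>
      convert h1 0 using 1
      ext x
      simp
    | succ k ih =>
      convert hΓ.union ih (h1 (k + 1)) using 1
      ext x
      constructor
      · rintro ⟨q, hq, hx⟩
        rcases hq.eq_or_lt with rfl | hq
        · exact Or.inr hx
        · exact Or.inl ⟨q, by omega, hx⟩
      · rintro (⟨q, hq, hx⟩ | hx)
        · exact ⟨q, by omega, hx⟩
        · exact ⟨_, le_rfl, hx⟩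
  have hlim : ∀ U : ℕ → Set Cantor, (∀ b, IsClopen (U b)) → IsGδ {x | ∀ k, ∃ b ≥ k, x ∈ U b} := by
    intro U hU
    have : {x | ∀ k, ∃ b ≥ k, x ∈ U b} = ⋂ k : ℕ, ⋃ b : {b // b ≥ k}, U b.1 := by
      ext x; simp
    rw [this]
    exact .iInter_of_isOpen fun k => isOpen_iUnion fun b => (hU _).isOpen
  refine hΓ.cover (ι := Option ℕ)
    (M := fun o => o.elim {x | ∀ k, ∃ b ≥ k, IsBad x b} fun k => {x | ∀ b, k ≤ b → ¬ IsBad x b})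
    (S := fun o => o.elim {x | ∀ k, ∃ q ≥ k, Reach 𝔽 α x q} fun k =>
      {x | ∃ q ≤ k, Reach 𝔽 α x q ∧ (fun n => x (q + n)) ∈ codeSet 𝔽 α}) ?_ ?_ ?_ ?_
  · rintro (_ | k)
    · exact hlim _ isClopen_isBad
    · refine IsClosed.isGδ_cantor ?_
      have : {x | ∀ b, k ≤ b → ¬ IsBad x b} = ⋂ b : {b // k ≤ b}, {x | IsBad x b.1}ᶜ := by
        ext x; simp
      change IsClosed {x | ∀ b, k ≤ b → ¬ IsBad x b}
      rw [this]
      exact isClosed_iInter fun b => (isClopen_isBad _).compl.isClosed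
  · intro x
    by_cases hx : ∀ k, ∃ b ≥ k, IsBad x b
    · exact ⟨none, hx⟩
    · push Not at hx
      obtain ⟨k, hk⟩ := hx
      exact ⟨some k, hk⟩
  · rintro (_ | k)
    · exact hΓ.isGδ (hlim _ (isClopen_reach 𝔽 α))
    · exact hfin k
  · rintro (_ | k) x hx
    · exact mem_omegaPower_iff_hasPath.trans (hasPath_iff_of_bad hx)
    · exact mem_omegaPower_iff_hasPath.trans (hasPath_iff_of_good h𝔽 hx)

end

theorem InDict.congr {𝔽 : Set (Cantor × Cantor × (ℕ → ℕ))} {α α' : Cantor} {w : List (Fin 2)}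
    (h : InDict 𝔽 α w) (hα : ∀ j < w.length, α' j = α j) : InDict 𝔽 α' w := by
  obtain ⟨y, β, k, i, i', h1, h2, h3, h4, h5, h6, a, b, c, h7, h8, h9⟩ := h
  exact ⟨y, β, k, i, i', h1, h2, h3, h4, h5, h6, a, b, c, h7,
    fun j hj => (h8 j hj).trans (hα j (by omega)).symm, h9⟩

open Classical in
theorem continuous_decide_inDict (𝔽 : Set (Cantor × Cantor × (ℕ → ℕ))) :
    Continuous fun (α : Cantor) (w : List (Fin 2)) => decide (InDict 𝔽 α w) :=
  continuous_pi fun w => continuous_of_agree fun α => ⟨w.length, fun α' h => by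
    rw [decide_eq_decide]
    exact ⟨fun h' => h'.congr fun j hj => (h j hj).symm, fun h' => h'.congr h⟩⟩

/-- For every Borel B ⊆ 2^ω × 2^ω and every countable ordinal ξ ≥ 3, there is a continuous
map ψ : 2^ω → 2^{2^{<ω}} reducing {α | B_α ∈ Σ⁰_ξ} to Σ_ξ and {α | B_α ∈ Π⁰_ξ} to Π_ξ. -/
theorem sections_reduce_to_dictionaries (B : Set (Cantor × Cantor)) (hB : MeasurableSet B)
    (ξ : Ordinal.{0}) (hξ : 3 ≤ ξ) (hcount : ξ.card ≤ Cardinal.aleph0) :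
    ∃ ψ : Cantor → (List (Fin 2) → Bool), Continuous ψ ∧
      {α : Cantor | {β | (α, β) ∈ B} ∈ SigmaZero Cantor ξ} = ψ ⁻¹' SigmaDict ξ ∧
      {α : Cantor | {β | (α, β) ∈ B} ∈ PiZero Cantor ξ} = ψ ⁻¹' PiDict ξ := by
  classical
  have h1 : 1 ≤ ξ := le_trans (by exact_mod_cast (by norm_num : 1 ≤ 3)) hξ
  obtain ⟨𝔽, h𝔽, h⟩ := exists_closed_family hB h1 hcount
  have hc : Continuous (cutSeq 0 []) := continuous_cutSeq 0 []
  have hE : ∀ α, cutSeq 0 [] ⁻¹' omegaPower {w | InDict 𝔽 α w} = {y | ∃ β, (α, y, β) ∈ 𝔽} :=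
    fun α => Set.ext fun y => cutSeq_mem_omegaPower_iff h𝔽
  refine ⟨_, continuous_decide_inDict 𝔽, Set.ext fun α => ?_, Set.ext fun α => ?_⟩
  · obtain ⟨hσ, -, hσ', -⟩ := h α
    simp only [SigmaDict, Set.mem_ofPred_eq, Set.mem_preimage, decide_eq_true_eq]
    exact ⟨fun hα => (isNiceClass_sigmaZero hξ).omegaPower_mem h𝔽 (hσ hα),
      fun hA => hσ' (hE α ▸ sigmaZero_preimage hc hA)⟩
  · obtain ⟨-, hπ, -, hπ'⟩ := h α
    simp only [PiDict, Set.mem_ofPred_eq, Set.mem_preimage, decide_eq_true_eq]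
    exact ⟨fun hα => (isNiceClass_piZero hξ).omegaPower_mem h𝔽 (hπ hα),
      fun hA => hπ' (hE α ▸ piZero_preimage hc hA)⟩
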